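/- arXiv:1609.04473 — 4 statements merged into one kernel-verified Lean document; each statement's English description precedes it below -/
import Mathlib

section
/- (Size of C in big branch) For every δ < ∞ and every ε > 0 there exists γ > 0 such that: if f ∈ L_δ is an (a,b)-renormalizable Lorenz map with critical point c < γ and b > α + 1, then |C_+| ≤ ε · min{c − f_-^{−1}(c), f_+^{−1}(c) − c}. -/
open Set Filter Topology MeasureTheory Function

noncomputable section

/-- The nonlinearity `Nφ = D log Dφ = φ''/φ'`. -/
def nonlinearity (φ : ℝ → ℝ) : ℝ → ℝ := fun x => deriv (deriv φ) x / deriv φ x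

/-- The Schwarzian derivative `Sφ = D(Nφ) - (Nφ)²/2`. -/
def schwarzian (φ : ℝ → ℝ) : ℝ → ℝ := fun x =>
  deriv (nonlinearity φ) x - (nonlinearity φ x) ^ 2 / 2

/-- `φ` is an orientation-preserving C³ diffeomorphism of `[0,1]` with
nonpositive Schwarzian derivative. -/
structure IsSDiffeo (φ : ℝ → ℝ) : Prop where
  contDiff : ContDiffOn ℝ 3 φ (Icc 0 1)
  fix0 : φ 0 = 0
  fix1 : φ 1 = 1
  derivPos : ∀ x ∈ Icc (0:ℝ) 1, 0 < deriv φ x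
  schwNonpos : ∀ x ∈ Icc (0:ℝ) 1, schwarzian φ x ≤ 0

/-- The nonlinearity norm `‖φ‖ = sup |Nφ|` over `[0,1]`. -/
def diffeoNorm (φ : ℝ → ℝ) : ℝ := sSup ((fun x => |nonlinearity φ x|) '' Icc 0 1)

/-- Left branch of the standard family: `q₋(x) = u (1 - |(c-x)/c|^α)`. -/
def qminus (α u c : ℝ) : ℝ → ℝ := fun x => u * (1 - |(c - x) / c| ^ α)

/-- Right branch of the standard family: `q₊(x) = 1 + v (-1 + |(x-c)/(1-c)|^α)`. -/
def qplus (α v c : ℝ) : ℝ → ℝ := fun x => 1 + v * (-1 + |(x - c) / (1 - c)| ^ α)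

/-- A Lorenz map with critical exponent `α`: a tuple `(u,v,c,φ,ψ)` with
branches `f₋ = φ ∘ q₋` on `[0,c)` and `f₊ = ψ ∘ q₊` on `(c,1]`, such that
`x < f₋(x)` on `(0,c]` and `f₊(x) < x` on `[c,1)`. -/
structure LorenzMap (α : ℝ) where
  u : ℝ
  v : ℝ
  c : ℝ
  φ : ℝ → ℝ
  ψ : ℝ → ℝ
  hu : u ∈ Icc (0:ℝ) 1
  hv : v ∈ Icc (0:ℝ) 1
  hc : c ∈ Ioo (0:ℝ) 1
  hφ : IsSDiffeo φ
  hψ : IsSDiffeo ψ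
  hleft : ∀ x ∈ Ioc (0:ℝ) c, x < φ (qminus α u c x)
  hright : ∀ x ∈ Ico c (1:ℝ), ψ (qplus α v c x) < x

namespace LorenzMap

variable {α : ℝ}

/-- The left branch `f₋ = φ ∘ q₋`. -/
def fm (f : LorenzMap α) : ℝ → ℝ := fun x => f.φ (qminus α f.u f.c x)

/-- The right branch `f₊ = ψ ∘ q₊`. -/
def fp (f : LorenzMap α) : ℝ → ℝ := fun x => f.ψ (qplus α f.v f.c x)

/-- The Lorenz map as a function (its value at the critical point itself is
irrelevant; we use the right branch there). -/
def toFun (f : LorenzMap α) : ℝ → ℝ := fun x => if x < f.c then f.fm x else f.fp x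

/-- `f ∈ L_δ`: both diffeomorphic parts have nonlinearity norm `< δ`. -/
def memL (f : LorenzMap α) (δ : ℝ) : Prop := diffeoNorm f.φ < δ ∧ diffeoNorm f.ψ < δ

/-- The preimage `f₋⁻¹(y)` of a point under the left branch, taken in `[0, c]`. -/
def fmInv (f : LorenzMap α) : ℝ → ℝ := fun y => invFunOn f.fm (Icc 0 f.c) y

/-- The preimage `f₊⁻¹(y)` of a point under the right branch, taken in `[c, 1]`. -/
def fpInv (f : LorenzMap α) : ℝ → ℝ := fun y => invFunOn f.fp (Icc f.c 1) y

end LorenzMap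

/-- First return time of `x` to `C` under `F`. -/
def firstReturn (F : ℝ → ℝ) (C : Set ℝ) (x : ℝ) : ℕ := sInf {k : ℕ | 0 < k ∧ F^[k] x ∈ C}

/-- `[l,r] ⊊ [0,1]` is a renormalization interval for `f`, whose first-return map
is affinely conjugate to the Lorenz map `g`. -/
def IsRenormPair {α : ℝ} (f g : LorenzMap α) (l r : ℝ) : Prop :=
  0 ≤ l ∧ l < f.c ∧ f.c < r ∧ r ≤ 1 ∧ (0 < l ∨ r < 1) ∧
  g.c = (f.c - l) / (r - l) ∧
  ∀ x ∈ Icc l r, x ≠ f.c →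
    (∃ k, 0 < k ∧ f.toFun^[k] x ∈ Icc l r) ∧
    f.toFun^[firstReturn f.toFun (Icc l r) x] x = l + (r - l) * g.toFun ((x - l) / (r - l))

/-- `f` is renormalizable. -/
def Renormalizable {α : ℝ} (f : LorenzMap α) : Prop := ∃ g l r, IsRenormPair f g l r

/-- `[l,r]` is the return interval of `f`: the largest renormalization interval. -/
def IsReturnInterval {α : ℝ} (f : LorenzMap α) (l r : ℝ) : Prop :=
  (∃ g, IsRenormPair f g l r) ∧
  ∀ g' l' r', IsRenormPair f g' l' r' → Icc l' r' ⊆ Icc l r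

/-- `g = R f` is the renormalization of `f` (rescaled first-return map to the
return interval). -/
def IsRenormalizationOf {α : ℝ} (f g : LorenzMap α) : Prop :=
  ∃ l r, IsReturnInterval f l r ∧ IsRenormPair f g l r

/-- The `(a,b)` combinatorics of renormalization on the interval `[l,r]`, where
`C₋ = [l,c)` and `C₊ = (c,r]`:
`f(C₋) > f²(C₋) > ⋯ > f^a(C₋) > c`, `C₋ ⊂ f^(a+1)(C₋) ⊂ C`, and
`f(C₊) < f²(C₊) < ⋯ < f^b(C₊) < c`, `C₊ ⊂ f^(b+1)(C₊) ⊂ C`. -/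
def ABCombinatorics {α : ℝ} (f : LorenzMap α) (l r : ℝ) (a b : ℕ) : Prop :=
  0 < a ∧ 0 < b ∧
  (∀ i, 1 ≤ i → i ≤ a → ∀ x ∈ Ico l f.c, f.c < f.toFun^[i] x) ∧
  (∀ i, 1 ≤ i → i + 1 ≤ a → ∀ x ∈ Ico l f.c, ∀ y ∈ Ico l f.c,
    f.toFun^[i+1] x < f.toFun^[i] y) ∧
  Ico l f.c ⊆ f.toFun^[a+1] '' Ico l f.c ∧ f.toFun^[a+1] '' Ico l f.c ⊆ Icc l r ∧
  (∀ i, 1 ≤ i → i ≤ b → ∀ x ∈ Ioc f.c r, f.toFun^[i] x < f.c) ∧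
  (∀ i, 1 ≤ i → i + 1 ≤ b → ∀ x ∈ Ioc f.c r, ∀ y ∈ Ioc f.c r,
    f.toFun^[i] x < f.toFun^[i+1] y) ∧
  Ioc f.c r ⊆ f.toFun^[b+1] '' Ioc f.c r ∧ f.toFun^[b+1] '' Ioc f.c r ⊆ Icc l r

/-- `f` is `(a,b)`-renormalizable with return interval `[l,r]`. -/
def ABRenormWith {α : ℝ} (f : LorenzMap α) (a b : ℕ) (l r : ℝ) : Prop :=
  IsReturnInterval f l r ∧ ABCombinatorics f l r a b

/-- `f` is `(a,b)`-renormalizable. -/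
def ABRenormalizable {α : ℝ} (f : LorenzMap α) (a b : ℕ) : Prop :=
  ∃ l r, ABRenormWith f a b l r

/-- A sequence of successive renormalizations: `F (k+1) = R (F k)`. -/
def RenormSeq {α : ℝ} (F : ℕ → LorenzMap α) : Prop :=
  ∀ k, IsRenormalizationOf (F k) (F (k + 1))

lemma nonlin_bdd {φ : ℝ → ℝ} (h : IsSDiffeo φ) :
    BddAbove ((fun x => |nonlinearity φ x|) '' Icc 0 1) := by
  have hu : UniqueDiffOn ℝ (Icc (0:ℝ) 1) := uniqueDiffOn_Icc zero_lt_one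
  have h1 : ContDiffOn ℝ 2 (derivWithin φ (Icc 0 1)) (Icc 0 1) :=
    h.contDiff.derivWithin hu (by norm_num)
  have h2 : ContDiffOn ℝ 1 (derivWithin (derivWithin φ (Icc 0 1)) (Icc 0 1)) (Icc 0 1) :=
    h1.derivWithin hu (by norm_num)
  have hd : ∀ x ∈ Icc (0:ℝ) 1, derivWithin φ (Icc 0 1) x = deriv φ x := fun x hx =>
    (differentiableAt_of_deriv_ne_zero (h.derivPos x hx).ne').derivWithin (hu x hx)
  have hcont : ContinuousOn (fun x => |derivWithin (derivWithin φ (Icc 0 1)) (Icc 0 1) x /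
      derivWithin φ (Icc 0 1) x|) (Icc 0 1) := by
    apply ContinuousOn.abs
    apply h2.continuousOn.div h1.continuousOn
    intro x hx
    rw [hd x hx]
    exact (h.derivPos x hx).ne'
  obtain ⟨B, hB⟩ := isCompact_Icc.bddAbove_image hcont
  refine ⟨max B (max |nonlinearity φ 0| |nonlinearity φ 1|), ?_⟩
  rintro _ ⟨x, hx, rfl⟩
  by_cases h0 : x = 0
  · subst h0; simp
  by_cases h1' : x = 1
  · subst h1'; simp
  have hx' : x ∈ Ioo (0:ℝ) 1 := ⟨lt_of_le_of_ne hx.1 (Ne.symm h0), lt_of_le_of_ne hx.2 h1'⟩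
  apply le_max_of_le_left
  have hnh : Icc (0:ℝ) 1 ∈ 𝓝 x := Icc_mem_nhds hx'.1 hx'.2
  have e : derivWithin (derivWithin φ (Icc 0 1)) (Icc 0 1) x = deriv (deriv φ) x := by
    rw [derivWithin_of_mem_nhds hnh]
    apply Filter.EventuallyEq.deriv_eq
    filter_upwards [hnh] with y hy using hd y hy
  have := hB ⟨x, hx, rfl⟩
  simp only [e, hd x hx] at this
  exact this

lemma distort {φ : ℝ → ℝ} {δ : ℝ} (h : IsSDiffeo φ) (hn : diffeoNorm φ < δ) :
    ∀ x y, 0 ≤ x → x ≤ y → y ≤ 1 →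
      y - x ≤ Real.exp δ * (φ y - φ x) ∧ φ y - φ x ≤ Real.exp δ * (y - x) := by
  have hN : ∀ x ∈ Icc (0:ℝ) 1, |nonlinearity φ x| ≤ δ := fun x hx =>
    (le_csSup (nonlin_bdd h) ⟨x, hx, rfl⟩).trans hn.le
  have hδ : 0 ≤ δ := (abs_nonneg _).trans (hN 0 (by simp))
  have hdiff : ∀ x ∈ Icc (0:ℝ) 1, DifferentiableAt ℝ φ x := fun x hx =>
    differentiableAt_of_deriv_ne_zero (h.derivPos x hx).ne'
  have hcont : ContinuousOn φ (Icc 0 1) := h.contDiff.continuousOn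
  have hd2 : ∀ x ∈ Ioo (0:ℝ) 1, DifferentiableAt ℝ (deriv φ) x := by
    intro x hx
    have h3 : ContDiffOn ℝ 3 φ (Ioo 0 1) := h.contDiff.mono Ioo_subset_Icc_self
    have h4 : ContDiffOn ℝ 2 (deriv φ) (Ioo 0 1) := h3.deriv_of_isOpen isOpen_Ioo (by norm_num)
    exact (h4.differentiableOn (by norm_num)).differentiableAt (isOpen_Ioo.mem_nhds hx)
  obtain ⟨ξ, hξ, hξ1⟩ := exists_deriv_eq_slope φ zero_lt_one hcont
    (fun x hx => (hdiff x (Ioo_subset_Icc_self hx)).differentiableWithinAt)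
  rw [h.fix0, h.fix1] at hξ1
  have hlog : ∀ x ∈ Ioo (0:ℝ) 1, |Real.log (deriv φ x)| ≤ δ := by
    intro x hx
    have := (convex_Ioo (0:ℝ) 1).norm_image_sub_le_of_norm_hasDerivWithin_le
      (f := fun x => Real.log (deriv φ x)) (f' := nonlinearity φ) (C := δ) (x := ξ) (y := x)
      (fun y hy => ((hd2 y hy).hasDerivAt.log
        (h.derivPos y (Ioo_subset_Icc_self hy)).ne').hasDerivWithinAt)
      (fun y hy => hN y (Ioo_subset_Icc_self hy)) hξ hx
    simp only [hξ1, Real.norm_eq_abs] at this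
    norm_num at this
    refine this.trans ?_
    have : |x - ξ| ≤ 1 := by
      rw [abs_le]; constructor <;> linarith [hx.1, hx.2, hξ.1, hξ.2]
    nlinarith
  intro x y hx hxy hy
  rcases hxy.eq_or_lt with rfl | hlt
  · simp
  have hsub : Icc x y ⊆ Icc 0 1 := Icc_subset_Icc hx hy
  obtain ⟨η, hη, hη1⟩ := exists_deriv_eq_slope φ hlt (hcont.mono hsub)
    (fun z hz => (hdiff z (hsub (Ioo_subset_Icc_self hz))).differentiableWithinAt)
  have hη' : η ∈ Ioo (0:ℝ) 1 := ⟨by linarith [hη.1], by linarith [hη.2]⟩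
  have hp := h.derivPos η (Ioo_subset_Icc_self hη')
  have hl := abs_le.1 (hlog η hη')
  have e1 : deriv φ η ≤ Real.exp δ := by
    rw [← Real.log_le_iff_le_exp hp]; exact hl.2
  have e2 : Real.exp (-δ) ≤ deriv φ η := by
    rw [← Real.le_log_iff_exp_le hp]; exact hl.1
  have hpos : 0 < y - x := sub_pos.2 hlt
  rw [eq_div_iff hpos.ne'] at hη1
  rw [← hη1]
  constructor
  · have : 1 ≤ Real.exp δ * deriv φ η := by
      calc (1:ℝ) = Real.exp δ * Real.exp (-δ) := by rw [← Real.exp_add]; simp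
        _ ≤ _ := by gcongr
    nlinarith
  · gcongr

namespace LorenzMap
variable {α : ℝ}

lemma qm_eq (f : LorenzMap α) {x : ℝ} (hx : x ≤ f.c) :
    qminus α f.u f.c x = f.u * (1 - ((f.c - x) / f.c) ^ α) := by
  unfold qminus
  rw [abs_of_nonneg (div_nonneg (by linarith) f.hc.1.le)]

lemma qp_eq (f : LorenzMap α) {x : ℝ} (hx : f.c ≤ x) :
    qplus α f.v f.c x = 1 + f.v * (-1 + ((x - f.c) / (1 - f.c)) ^ α) := by
  unfold qplus
  rw [abs_of_nonneg (div_nonneg (by linarith) (by linarith [f.hc.2]))]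

lemma sm_mem (f : LorenzMap α) (hα : 1 < α) {x : ℝ} (h0 : 0 ≤ x) (hx : x ≤ f.c) :
    0 ≤ ((f.c - x) / f.c) ^ α ∧ ((f.c - x) / f.c) ^ α ≤ (f.c - x) / f.c ∧
      (f.c - x) / f.c ≤ 1 := by
  have hc := f.hc.1
  have a0 : 0 ≤ (f.c - x) / f.c := div_nonneg (by linarith) hc.le
  have a1 : (f.c - x) / f.c ≤ 1 := by rw [div_le_one hc]; linarith
  exact ⟨Real.rpow_nonneg a0 _, Real.rpow_le_self_of_le_one a0 a1 hα.le, a1⟩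

lemma sp_mem (f : LorenzMap α) (hα : 1 < α) {x : ℝ} (h0 : f.c ≤ x) (hx : x ≤ 1) :
    0 ≤ ((x - f.c) / (1 - f.c)) ^ α ∧ ((x - f.c) / (1 - f.c)) ^ α ≤ 1 := by
  have hc := f.hc.2
  have a0 : 0 ≤ (x - f.c) / (1 - f.c) := div_nonneg (by linarith) (by linarith)
  have a1 : (x - f.c) / (1 - f.c) ≤ 1 := by rw [div_le_one (by linarith)]; linarith
  exact ⟨Real.rpow_nonneg a0 _, Real.rpow_le_one a0 a1 (by linarith)⟩

lemma qm_mem (f : LorenzMap α) (hα : 1 < α) {x : ℝ} (h0 : 0 ≤ x) (hx : x ≤ f.c) :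
    0 ≤ qminus α f.u f.c x ∧ qminus α f.u f.c x ≤ f.u := by
  obtain ⟨h1, h2, h3⟩ := f.sm_mem hα h0 hx
  rw [f.qm_eq hx]
  have := f.hu.1
  constructor <;> nlinarith

lemma qp_mem (f : LorenzMap α) (hα : 1 < α) {x : ℝ} (h0 : f.c ≤ x) (hx : x ≤ 1) :
    1 - f.v ≤ qplus α f.v f.c x ∧ qplus α f.v f.c x ≤ 1 := by
  obtain ⟨h1, h2⟩ := f.sp_mem hα h0 hx
  rw [f.qp_eq h0]
  have := f.hv.1
  constructor <;> nlinarith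

lemma qm_mono (f : LorenzMap α) (hα : 1 < α) {x y : ℝ} (hxy : x ≤ y) (hy : y ≤ f.c) :
    qminus α f.u f.c x ≤ qminus α f.u f.c y := by
  rw [f.qm_eq hy, f.qm_eq (hxy.trans hy)]
  have hc := f.hc.1
  have a0 : 0 ≤ (f.c - y) / f.c := div_nonneg (by linarith) hc.le
  have := f.hu.1
  have h : ((f.c - y) / f.c) ^ α ≤ ((f.c - x) / f.c) ^ α := by
    apply Real.rpow_le_rpow a0 _ (by linarith)
    gcongr
  nlinarith

lemma qp_mono (f : LorenzMap α) (hα : 1 < α) {x y : ℝ} (hx : f.c ≤ x) (hxy : x ≤ y) :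
    qplus α f.v f.c x ≤ qplus α f.v f.c y := by
  rw [f.qp_eq hx, f.qp_eq (hx.trans hxy)]
  have hc := f.hc.2
  have a0 : 0 ≤ (x - f.c) / (1 - f.c) := div_nonneg (by linarith) (by linarith)
  have := f.hv.1
  have h : ((x - f.c) / (1 - f.c)) ^ α ≤ ((y - f.c) / (1 - f.c)) ^ α := by
    apply Real.rpow_le_rpow a0 _ (by linarith)
    have : 0 < 1 - f.c := by linarith
    gcongr
  nlinarith

end LorenzMap

lemma IsSDiffeo.mono {φ : ℝ → ℝ} {δ : ℝ} (h : IsSDiffeo φ) (hn : diffeoNorm φ < δ)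
    {x y : ℝ} (hx : 0 ≤ x) (hxy : x ≤ y) (hy : y ≤ 1) : φ x ≤ φ y := by
  have := (distort h hn x y hx hxy hy).1
  have h2 : 0 ≤ Real.exp δ * (φ y - φ x) := by linarith
  have := nonneg_of_mul_nonneg_right h2 (Real.exp_pos δ)
  linarith

namespace LorenzMap
variable {α δ : ℝ}

lemma fm_mono (f : LorenzMap α) (hα : 1 < α) (hn : diffeoNorm f.φ < δ)
    {x y : ℝ} (h0 : 0 ≤ x) (hxy : x ≤ y) (hy : y ≤ f.c) : f.fm x ≤ f.fm y :=
  f.hφ.mono hn (f.qm_mem hα h0 (hxy.trans hy)).1 (f.qm_mono hα hxy hy)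
    ((f.qm_mem hα (h0.trans hxy) hy).2.trans f.hu.2)

lemma fp_mono (f : LorenzMap α) (hα : 1 < α) (hn : diffeoNorm f.ψ < δ)
    {x y : ℝ} (h0 : f.c ≤ x) (hxy : x ≤ y) (hy : y ≤ 1) : f.fp x ≤ f.fp y :=
  f.hψ.mono hn ((sub_nonneg.2 f.hv.2).trans (f.qp_mem hα h0 (hxy.trans hy)).1)
    (f.qp_mono hα h0 hxy) ((f.qp_mem hα (h0.trans hxy) hy).2)

lemma fm_zero (f : LorenzMap α) (_hα : 1 < α) : f.fm 0 = 0 := by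
  unfold fm
  rw [f.qm_eq f.hc.1.le]
  simp [f.hc.1.ne', f.hφ.fix0]

lemma qm_c (f : LorenzMap α) (hα : 1 < α) : qminus α f.u f.c f.c = f.u := by
  rw [f.qm_eq le_rfl]
  simp [Real.zero_rpow (show α ≠ 0 by linarith)]

lemma qp_c (f : LorenzMap α) (hα : 1 < α) : qplus α f.v f.c f.c = 1 - f.v := by
  rw [f.qp_eq le_rfl]
  simp [Real.zero_rpow (show α ≠ 0 by linarith)]
  ring

lemma fp_one (f : LorenzMap α) : f.fp 1 = 1 := by
  unfold fp
  rw [f.qp_eq f.hc.2.le, div_self (by linarith [f.hc.2])]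
  simp [f.hψ.fix1]

lemma fm_lower (f : LorenzMap α) (hα : 1 < α) (hn : diffeoNorm f.φ < δ)
    {x : ℝ} (h0 : 0 ≤ x) (hx : x ≤ f.c) : f.u / (Real.exp δ * f.c) * x ≤ f.fm x := by
  obtain ⟨h1, h2, h3⟩ := f.sm_mem hα h0 hx
  have hq := f.qm_mem hα h0 hx
  have hd := (distort f.hφ hn 0 _ le_rfl hq.1 (hq.2.trans f.hu.2)).1
  rw [f.hφ.fix0] at hd
  have hc := f.hc.1
  have hq2 : f.u * (x / f.c) ≤ qminus α f.u f.c x := by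
    rw [f.qm_eq hx]
    have : x / f.c = 1 - (f.c - x) / f.c := by field_simp; ring
    rw [this]
    have := f.hu.1
    gcongr
  have hD := Real.exp_pos δ
  have : f.u / (Real.exp δ * f.c) * x = f.u * (x / f.c) / Real.exp δ := by field_simp
  rw [this, div_le_iff₀ hD, mul_comm]
  unfold fm
  linarith

/-- upper estimate for the distance of the critical value to a point, left branch -/
lemma fm_upper (f : LorenzMap α) (hα : 1 < α) (hn : diffeoNorm f.φ < δ)
    {x : ℝ} (h0 : 0 ≤ x) (hx : x ≤ f.c) :
    f.fm f.c - f.fm x ≤ Real.exp δ * (f.u * ((f.c - x) / f.c) ^ α) := by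
  have hq := f.qm_mem hα h0 hx
  have hd := (distort f.hφ hn _ f.u hq.1 hq.2 f.hu.2).2
  unfold fm
  rw [f.qm_c hα]
  refine hd.trans (le_of_eq ?_)
  rw [f.qm_eq hx]
  ring

lemma fp_est (f : LorenzMap α) (hα : 1 < α) (hn : diffeoNorm f.ψ < δ)
    {x : ℝ} (h0 : f.c ≤ x) (hx : x ≤ 1) :
    f.fp x - f.fp f.c ≤ Real.exp δ * (f.v * ((x - f.c) / (1 - f.c)) ^ α) ∧
    f.v * ((x - f.c) / (1 - f.c)) ^ α ≤ Real.exp δ * (f.fp x - f.fp f.c) := by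
  have hq := f.qp_mem hα h0 hx
  have hd := distort f.hψ hn _ _ (sub_nonneg.2 f.hv.2) hq.1 hq.2
  have e : qplus α f.v f.c x - (1 - f.v) = f.v * ((x - f.c) / (1 - f.c)) ^ α := by
    rw [f.qp_eq h0]; ring
  rw [e] at hd
  unfold fp
  rw [f.qp_c hα]
  exact ⟨hd.2, hd.1⟩

lemma fm_contOn (f : LorenzMap α) (hα : 1 < α) : ContinuousOn f.fm (Icc 0 f.c) := by
  refine f.hφ.contDiff.continuousOn.comp (t := Icc 0 1) ?_ ?_
  · unfold qminus
    refine ContinuousOn.mul continuousOn_const (continuousOn_const.sub ?_)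
    exact ContinuousOn.rpow_const (by fun_prop) (fun x _ => Or.inr (by linarith))
  · intro x hx
    have := f.qm_mem hα hx.1 hx.2
    exact ⟨this.1, this.2.trans f.hu.2⟩

lemma fp_contOn (f : LorenzMap α) (hα : 1 < α) : ContinuousOn f.fp (Icc f.c 1) := by
  refine f.hψ.contDiff.continuousOn.comp (t := Icc 0 1) ?_ ?_
  · unfold qplus
    refine continuousOn_const.add (ContinuousOn.mul continuousOn_const
      (continuousOn_const.add ?_))
    exact ContinuousOn.rpow_const (by fun_prop) (fun x _ => Or.inr (by linarith))
  · intro x hx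
    have := f.qp_mem hα hx.1 hx.2
    exact ⟨(sub_nonneg.2 f.hv.2).trans this.1, this.2⟩

lemma fmInv_spec (f : LorenzMap α) (hα : 1 < α) :
    f.fmInv f.c ∈ Icc 0 f.c ∧ f.fm (f.fmInv f.c) = f.c := by
  have hc := f.hc
  have h : f.c ∈ f.fm '' Icc 0 f.c := by
    apply intermediate_value_Icc hc.1.le (f.fm_contOn hα)
    rw [f.fm_zero hα]
    exact ⟨hc.1.le, (f.hleft f.c ⟨hc.1, le_rfl⟩).le⟩
  exact ⟨invFunOn_mem h, invFunOn_eq h⟩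

lemma fpInv_spec (f : LorenzMap α) (hα : 1 < α) :
    f.fpInv f.c ∈ Icc f.c 1 ∧ f.fp (f.fpInv f.c) = f.c := by
  have hc := f.hc
  have h : f.c ∈ f.fp '' Icc f.c 1 := by
    apply intermediate_value_Icc hc.2.le (f.fp_contOn hα)
    rw [f.fp_one]
    exact ⟨(f.hright f.c ⟨le_rfl, hc.2⟩).le, hc.2.le⟩
  exact ⟨invFunOn_mem h, invFunOn_eq h⟩

end LorenzMap

namespace LorenzMap
variable {α δ : ℝ}

lemma fm_range (f : LorenzMap α) (hα : 1 < α) (hn : diffeoNorm f.φ < δ)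
    {x : ℝ} (h0 : 0 ≤ x) (hx : x ≤ f.c) : 0 ≤ f.fm x ∧ f.fm x ≤ 1 := by
  have hq := f.qm_mem hα h0 hx
  constructor
  · have := f.hφ.mono hn le_rfl hq.1 (hq.2.trans f.hu.2)
    rwa [f.hφ.fix0] at this
  · have := f.hφ.mono hn hq.1 (hq.2.trans f.hu.2) le_rfl
    rwa [f.hφ.fix1] at this

lemma fp_nonneg (f : LorenzMap α) (hα : 1 < α) (hn : diffeoNorm f.ψ < δ)
    {x : ℝ} (h0 : f.c ≤ x) (hx : x ≤ 1) : 0 ≤ f.fp x := by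
  have hq := f.qp_mem hα h0 hx
  have := f.hψ.mono hn le_rfl ((sub_nonneg.2 f.hv.2).trans hq.1) hq.2
  rwa [f.hψ.fix0] at this

lemma toFun_lt (f : LorenzMap α) {x : ℝ} (h : x < f.c) : f.toFun x = f.fm x := by
  simp [toFun, h]

lemma toFun_gt (f : LorenzMap α) {x : ℝ} (h : f.c ≤ x) : f.toFun x = f.fp x := by
  simp [toFun, not_lt.2 h]

/-- the image of the left critical value under the right branch lies to the right of `c` -/
lemma fp_crit (f : LorenzMap α) (hα : 1 < α) (hm : f.memL δ) {a b : ℕ} {l r : ℝ}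
    (hl0 : 0 ≤ l) (hlc : l < f.c) (h : ABCombinatorics f l r a b) : f.c ≤ f.fp (f.fm f.c) := by
  obtain ⟨ha, hb, h1, -, h3, -⟩ := h
  have hw1 := (f.fm_range hα hm.1 f.hc.1.le le_rfl).2
  have key : ∀ x ∈ Ico l f.c, f.toFun^[2] x ≤ f.fp (f.fm f.c) := by
    intro x hx
    have hx1 := h1 1 le_rfl ha x hx
    simp only [iterate_succ, iterate_zero, comp_apply, id] at hx1 ⊢
    rw [f.toFun_lt hx.2] at hx1 ⊢
    rw [f.toFun_gt hx1.le]
    exact f.fp_mono hα hm.2 hx1.le (f.fm_mono hα hm.1 (hl0.trans hx.1) hx.2.le le_rfl) hw1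
  by_cases ha2 : 2 ≤ a
  · exact (h1 2 (by norm_num) ha2 l ⟨le_rfl, hlc⟩).le.trans (key l ⟨le_rfl, hlc⟩)
  · have : a = 1 := by omega
    subst this
    by_contra hcon
    push Not at hcon
    obtain ⟨y, hy1, hy2⟩ := exists_between (max_lt hlc hcon)
    obtain ⟨x, hx, hxy⟩ := h3 ⟨((le_max_left _ _).trans_lt hy1).le, hy2⟩
    have := key x hx
    rw [hxy] at this
    linarith [(le_max_right _ _).trans_lt hy1]

/-- expansion along the left branch -/
lemma iter_lower (f : LorenzMap α) (hα : 1 < α) (hm : f.memL δ) {a b : ℕ} {l r : ℝ}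
    (hcr : f.c < r) (hr1 : r ≤ 1) (h : ABCombinatorics f l r a b) :
    ∀ n, n + 1 ≤ b → 0 ≤ f.toFun^[n+1] r ∧
      (f.u / (Real.exp δ * f.c)) ^ n * f.fp r ≤ f.toFun^[n+1] r := by
  obtain ⟨ha, hb, -, -, -, -, h7, -⟩ := h
  have hM : 0 ≤ f.u / (Real.exp δ * f.c) :=
    div_nonneg f.hu.1 (mul_nonneg (Real.exp_pos δ).le f.hc.1.le)
  intro n
  induction n with
  | zero =>
    intro _
    simp only [zero_add, iterate_one, pow_zero, one_mul]
    rw [f.toFun_gt hcr.le]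
    exact ⟨f.fp_nonneg hα hm.2 hcr.le hr1, le_rfl⟩
  | succ n ih =>
    intro hn
    obtain ⟨i1, i2⟩ := ih (by omega)
    have hlt := h7 (n+1) (by omega) (by omega) r ⟨hcr, le_rfl⟩
    rw [iterate_succ_apply', f.toFun_lt hlt]
    refine ⟨(f.fm_range hα hm.1 i1 hlt.le).1, ?_⟩
    refine le_trans ?_ (f.fm_lower hα hm.1 i1 hlt.le)
    rw [pow_succ', mul_assoc]
    gcongr

lemma fp_up (f : LorenzMap α) (hα : 1 < α) (hn : diffeoNorm f.ψ < δ) (hc : f.c ≤ 1 / 2)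
    {x : ℝ} (h0 : f.c ≤ x) (hx : x ≤ 1) :
    f.fp x - f.fp f.c ≤ Real.exp δ * (2 * (x - f.c)) ^ α := by
  refine (f.fp_est hα hn h0 hx).1.trans ?_
  have hD := Real.exp_pos δ
  have h1 : 0 < 1 - f.c := by linarith
  have a0 : 0 ≤ (x - f.c) / (1 - f.c) := div_nonneg (by linarith) h1.le
  have : ((x - f.c) / (1 - f.c)) ^ α ≤ (2 * (x - f.c)) ^ α := by
    apply Real.rpow_le_rpow a0 _ (by linarith)
    rw [div_le_iff₀ h1]
    nlinarith
  have h2 := Real.rpow_nonneg a0 α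
  have := f.hv.2
  have := f.hv.1
  gcongr
  nlinarith

lemma u_lower (f : LorenzMap α) (hα : 1 < α) (hm : f.memL δ) (hc : f.c ≤ 1 / 2)
    (hA : f.c ≤ f.fp (f.fm f.c)) (hB : f.fm (f.fp f.c) ≤ f.c) :
    f.c ≤ Real.exp δ * (2 * (Real.exp δ * f.u)) ^ α := by
  have hc0 := f.hc.1
  have hD := Real.exp_pos δ
  have hu := f.hu.1
  have hz0 : 0 ≤ f.fp f.c := f.fp_nonneg hα hm.2 le_rfl f.hc.2.le
  have hzc : f.fp f.c < f.c := f.hright f.c ⟨le_rfl, f.hc.2⟩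
  have hwc : f.c < f.fm f.c := f.hleft f.c ⟨hc0, le_rfl⟩
  have hw1 := (f.fm_range hα hm.1 hc0.le le_rfl).2
  have e1 := f.fp_up hα hm.2 hc hwc.le hw1
  have e2 := f.fm_upper hα hm.1 hz0 hzc.le
  obtain ⟨s0, s1, s2⟩ := f.sm_mem hα hz0 hzc.le
  set s := (f.c - f.fp f.c) / f.c with hs
  have hspos : 0 < s := div_pos (by linarith) hc0
  have hcs : f.c - f.fp f.c = f.c * s := by rw [hs]; field_simp
  have e3 : (2 * (f.fm f.c - f.c)) ^ α ≤ (2 * (Real.exp δ * f.u)) ^ α * (s ^ α) ^ α := by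
    rw [← Real.mul_rpow (by positivity) s0]
    apply Real.rpow_le_rpow (by linarith) _ (by linarith)
    nlinarith
  have e4 : (s ^ α) ^ α ≤ s :=
    (Real.rpow_le_self_of_le_one s0 (s1.trans s2) hα.le).trans s1
  have e5 : f.c * s ≤ (Real.exp δ * (2 * (Real.exp δ * f.u)) ^ α) * s := by
    have hk : 0 ≤ (2 * (Real.exp δ * f.u)) ^ α := by positivity
    calc f.c * s ≤ Real.exp δ * (2 * (f.fm f.c - f.c)) ^ α := by linarith
      _ ≤ Real.exp δ * ((2 * (Real.exp δ * f.u)) ^ α * s) := by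
        gcongr
        exact e3.trans (by gcongr)
      _ = _ := by ring
  exact le_of_mul_le_mul_right e5 hspos

end LorenzMap

set_option maxHeartbeats 1000000

/-- **Size of `C` in the big branch.** For every `δ < ∞` and `ε > 0` there exists
`γ > 0` such that if `f ∈ L_δ` is `(a,b)`-renormalizable, `c < γ` and `b > α + 1`,
then `|C₊| ≤ ε min{c - f₋⁻¹(c), f₊⁻¹(c) - c}`. -/
theorem size_of_C_in_big_branch (α : ℝ) (hα : 1 < α) (δ ε : ℝ) (hε : 0 < ε) :
    ∃ γ : ℝ, 0 < γ ∧ ∀ (f : LorenzMap α) (a b : ℕ) (l r : ℝ),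
      f.memL δ → ABRenormWith f a b l r → f.c < γ → α + 1 < (b : ℝ) →
      r - f.c ≤ ε * min (f.c - f.fmInv f.c) (f.fpInv f.c - f.c) := by
  set D := Real.exp δ with hD
  have hD0 : 0 < D := Real.exp_pos δ
  have hα0 : 0 < α := by linarith
  set A := D * (2 * (D * D)) ^ α with hA
  have hA0 : 0 < A := by positivity
  set β : ℝ := (⌊α⌋₊ : ℝ) + 1 - α with hβ
  have hβ0 : 0 < β := by have := Nat.lt_floor_add_one α; linarith
  set E := 2 * D * A / (ε / 2) ^ α with hE
  have hE0 : 0 < E := by positivity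
  set M0 := max 2 (E ^ (1 / β) + 1) with hM0
  have hM02 : 2 ≤ M0 := le_max_left _ _
  set η := min (1 / (A * M0 ^ α)) (1 / (2 * D)) with hη
  have hη0 : 0 < η := by
    have : 0 < M0 := by linarith
    apply lt_min <;> positivity
  set γ0 := η ^ (1 / (α - 1)) with hγ0
  have hγ0p : 0 < γ0 := by positivity
  refine ⟨min γ0 (min (1 / 2) (1 / (2 * D))), lt_min hγ0p (lt_min (by norm_num) (by positivity)),
    ?_⟩
  intro f a b l r hm hf hcγ hb
  obtain ⟨⟨⟨g, hl0, hlc, hcr, hr1, -⟩, -⟩, hcomb⟩ := hf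
  have hc0 := f.hc.1
  have hcγ0 : f.c < γ0 := hcγ.trans_le (min_le_left _ _)
  have hc2 : f.c ≤ 1 / 2 := (hcγ.trans_le ((min_le_right _ _).trans (min_le_left _ _))).le
  have hcD : f.c ≤ 1 / (2 * D) := (hcγ.trans_le ((min_le_right _ _).trans (min_le_right _ _))).le
  have hcη : f.c ^ (α - 1) < η := by
    have := Real.rpow_lt_rpow hc0.le hcγ0 (show 0 < α - 1 by linarith)
    rwa [hγ0, ← Real.rpow_mul hη0.le, one_div_mul_cancel (by linarith), Real.rpow_one] at this
  have hcα : f.c ^ α = f.c * f.c ^ (α - 1) := by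
    rw [Real.rpow_sub_one hc0.ne']; field_simp
  -- combinatorial facts
  have hb2 : 2 ≤ b := by
    have : (2:ℝ) < b := by linarith
    exact_mod_cast this.le
  have h7 := hcomb.2.2.2.2.2.2.1
  have hfA := f.fp_crit hα hm hl0 hlc hcomb
  have hz0 : 0 ≤ f.fp f.c := f.fp_nonneg hα hm.2 le_rfl f.hc.2.le
  have hzc : f.fp f.c < f.c := f.hright f.c ⟨le_rfl, f.hc.2⟩
  have hfB : f.fm (f.fp f.c) ≤ f.c := by
    have h1 := h7 1 le_rfl (by omega) r ⟨hcr, le_rfl⟩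
    have h2 := h7 2 (by norm_num) hb2 r ⟨hcr, le_rfl⟩
    simp only [iterate_succ, iterate_zero, comp_apply, id] at h1 h2
    rw [f.toFun_gt hcr.le] at h1 h2
    rw [f.toFun_lt h1] at h2
    exact (f.fm_mono hα hm.1 hz0 (f.fp_mono hα hm.2 le_rfl hcr.le hr1) h1.le).trans h2.le
  have hu := f.u_lower hα hm hc2 hfA hfB
  set M := f.u / (D * f.c) with hM
  have hMnn : 0 ≤ M := div_nonneg f.hu.1 (by positivity)
  have hMc : 1 ≤ A * f.c ^ (α - 1) * M ^ α := by
    have e : 2 * (D * f.u) = (2 * (D * D)) * (f.c * M) := by rw [hM]; field_simp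
    rw [← hD, e, Real.mul_rpow (by positivity) (by positivity), Real.mul_rpow hc0.le hMnn, hcα] at hu
    have : f.c * 1 ≤ f.c * (A * f.c ^ (α - 1) * M ^ α) := by
      rw [hA]; linarith
    exact le_of_mul_le_mul_left this hc0
  have hMM0 : M0 ≤ M := by
    by_contra hcon
    push Not at hcon
    have h1 : M ^ α ≤ M0 ^ α := Real.rpow_le_rpow hMnn hcon.le hα0.le
    have hM0p : 0 < M0 ^ α := by apply Real.rpow_pos_of_pos; linarith
    have h2 : f.c ^ (α - 1) < 1 / (A * M0 ^ α) := hcη.trans_le (min_le_left _ _)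
    rw [lt_div_iff₀ (by positivity)] at h2
    have h3 : A * f.c ^ (α - 1) * M ^ α ≤ A * f.c ^ (α - 1) * M0 ^ α := by
      have : 0 ≤ f.c ^ (α - 1) := by positivity
      gcongr
    nlinarith
  have hM2 : 2 ≤ M := hM02.trans hMM0
  have hM1 : 1 ≤ M := by linarith
  have hM0' : 0 < M := by linarith
  -- the two gaps
  have hz2 : f.fp f.c ≤ f.c / 2 := by
    have := f.fm_lower hα hm.1 hz0 hzc.le
    rw [← hD, ← hM] at this
    nlinarith
  have hgap1 : f.c / 2 ≤ f.c - f.fmInv f.c := by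
    obtain ⟨ht, ht2⟩ := f.fmInv_spec hα
    have := f.fm_lower hα hm.1 ht.1 ht.2
    rw [← hD, ← hM, ht2] at this
    nlinarith [ht.1]
  have hgap2 : f.c / 2 ≤ f.fpInv f.c - f.c := by
    obtain ⟨hp, hp2⟩ := f.fpInv_spec hα
    have := f.fp_up hα hm.2 hc2 hp.1 hp.2
    rw [hp2, ← hD] at this
    by_contra hcon
    push Not at hcon
    have h1 : (2 * (f.fpInv f.c - f.c)) ^ α ≤ f.c ^ α :=
      Real.rpow_le_rpow (by linarith [hp.1]) (by linarith) hα0.le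
    have h2 : f.c ^ (α - 1) < 1 / (2 * D) := hcη.trans_le (min_le_right _ _)
    rw [lt_div_iff₀ (by positivity)] at h2
    have h3 : f.c / 2 ≤ D * f.c ^ α := by
      have := mul_le_mul_of_nonneg_left h1 hD0.le
      linarith
    rw [hcα] at h3
    have h4 := mul_lt_mul_of_pos_left h2 hc0
    linarith
  -- the size of the right half
  have hN : r - f.c ≤ ε * (f.c / 2) := by
    by_contra hcon
    push Not at hcon
    have hv : 1 / 2 ≤ f.v := by
      have h1 := (distort f.hψ hm.2 0 (1 - f.v) le_rfl (by linarith [f.hv.2])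
        (by linarith [f.hv.1])).1
      have e : f.ψ (1 - f.v) = f.fp f.c := by unfold LorenzMap.fp; rw [f.qp_c hα]
      rw [f.hψ.fix0, e, ← hD] at h1
      rw [le_div_iff₀ (by positivity)] at hcD
      nlinarith
    have e1 := (f.fp_est hα hm.2 hcr.le hr1).2
    rw [← hD] at e1
    have e2 : (ε * (f.c / 2)) ^ α ≤ ((r - f.c) / (1 - f.c)) ^ α := by
      apply Real.rpow_le_rpow (by positivity) _ hα0.le
      rw [le_div_iff₀ (by linarith)]
      have : 0 < ε * (f.c / 2) := by positivity
      nlinarith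
    have e3 : (ε * (f.c / 2)) ^ α ≤ 2 * D * f.fp r := by
      have h0 : 0 ≤ (ε * (f.c / 2)) ^ α := by positivity
      nlinarith
    have e4 : M ^ (b - 1) * f.fp r ≤ f.c := by
      have h1 := (f.iter_lower hα hm hcr hr1 hcomb (b - 1) (by omega)).2
      have h2 := h7 (b - 1 + 1) (by omega) (by omega) r ⟨hcr, le_rfl⟩
      rw [← hD, ← hM] at h1
      linarith
    have e5 : M ^ α * M ^ β ≤ M ^ (b - 1) := by
      rw [← Real.rpow_add hM0', ← Real.rpow_natCast]
      apply Real.rpow_le_rpow_of_exponent_le hM1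
      have h1 : ⌊α⌋₊ + 1 ≤ b - 1 := by
        have h2 : (⌊α⌋₊ : ℝ) ≤ α := Nat.floor_le hα0.le
        have h3 : ((⌊α⌋₊ + 1 : ℕ) : ℝ) < b := by push_cast; linarith
        have h4 : ⌊α⌋₊ + 1 < b := by exact_mod_cast h3
        omega
      have h2 : ((⌊α⌋₊ + 1 : ℕ) : ℝ) ≤ ((b - 1 : ℕ) : ℝ) := by exact_mod_cast h1
      push_cast at h2
      push_cast
      linarith
    have hfr : 0 ≤ f.fp r := f.fp_nonneg hα hm.2 hcr.le hr1
    have hEM : M ^ β ≤ E := by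
      rw [hE, le_div_iff₀ (by positivity)]
      have q1 : (ε * (f.c / 2)) ^ α = (ε / 2) ^ α * (f.c * f.c ^ (α - 1)) := by
        rw [← hcα, ← Real.mul_rpow (by positivity) hc0.le]; ring_nf
      have q2 : (ε * (f.c / 2)) ^ α * (M ^ α * M ^ β) ≤ 2 * D * f.c := by
        calc (ε * (f.c / 2)) ^ α * (M ^ α * M ^ β) ≤ (2 * D * f.fp r) * M ^ (b - 1) := by
              gcongr
          _ = 2 * D * (M ^ (b - 1) * f.fp r) := by ring
          _ ≤ _ := by gcongr
      rw [q1] at q2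
      have q3 : (ε / 2) ^ α * f.c ^ (α - 1) * M ^ α * M ^ β ≤ 2 * D := by
        apply le_of_mul_le_mul_left _ hc0
        linarith
      have q4 : 0 ≤ (ε / 2) ^ α * M ^ β := by positivity
      calc M ^ β * (ε / 2) ^ α = ((ε / 2) ^ α * M ^ β) * 1 := by ring
        _ ≤ ((ε / 2) ^ α * M ^ β) * (A * f.c ^ (α - 1) * M ^ α) := by gcongr
        _ = A * ((ε / 2) ^ α * f.c ^ (α - 1) * M ^ α * M ^ β) := by ring
        _ ≤ A * (2 * D) := by gcongr
        _ = _ := by ring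
    have hlt : E ^ (1 / β) < M := by
      have := (le_max_right 2 (E ^ (1 / β) + 1)).trans hMM0
      linarith
    have h8 := Real.rpow_lt_rpow (by positivity) hlt hβ0
    rw [← Real.rpow_mul hE0.le, one_div_mul_cancel hβ0.ne', Real.rpow_one] at h8
    linarith
  refine hN.trans ?_
  gcongr
  exact le_min hgap1 hgap2
end
end

section
/- (Critical preimage upper bounds) Let κ = e^{δ/(α−1)}·α/(α−1) and α_n = α^{−n}. If f ∈ L_δ is a Lorenz map with critical point c, then for every n ≥ 1: c − f_-^{−n}(c) ≤ κ·c·(1−c)^{α_n} and f_+^{−n}(c) − c ≤ κ·(1−c)·c^{α_n}. -/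
open Set Filter Topology MeasureTheory Function

noncomputable section

namespace CritAux

lemma distort_aux {φ : ℝ → ℝ} (h : IsSDiffeo φ) {δ : ℝ} (hδ : diffeoNorm φ < δ) :
    (∀ x ∈ Ioo (0:ℝ) 1, |nonlinearity φ x| ≤ δ) ∧ 0 < δ := by
  have hdiff : ∀ x ∈ Icc (0:ℝ) 1, DifferentiableAt ℝ φ x := fun x hx =>
    differentiableAt_of_deriv_ne_zero (h.derivPos x hx).ne'
  have hU : UniqueDiffOn ℝ (Icc (0:ℝ) 1) := uniqueDiffOn_Icc one_pos
  have hd1 : ∀ x ∈ Icc (0:ℝ) 1, derivWithin φ (Icc 0 1) x = deriv φ x := fun x hx =>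
    (hdiff x hx).derivWithin (hU x hx)
  have hC2 : ContDiffOn ℝ 2 (derivWithin φ (Icc 0 1)) (Icc 0 1) :=
    h.contDiff.derivWithin hU (by norm_num)
  have hC1 : ContDiffOn ℝ 1 (derivWithin (derivWithin φ (Icc 0 1)) (Icc 0 1)) (Icc 0 1) :=
    hC2.derivWithin hU (by norm_num)
  have hcont : ContinuousOn (fun x => derivWithin (derivWithin φ (Icc 0 1)) (Icc 0 1) x /
      derivWithin φ (Icc 0 1) x) (Icc 0 1) := by
    refine hC1.continuousOn.div hC2.continuousOn ?_
    intro x hx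
    rw [hd1 x hx]
    exact (h.derivPos x hx).ne'
  obtain ⟨C, hC⟩ := isCompact_Icc.exists_bound_of_continuousOn hcont
  have hN : ∀ x ∈ Ioo (0:ℝ) 1, |nonlinearity φ x| ≤ C := by
    intro x hx
    have hxI := Ioo_subset_Icc_self hx
    have hnhds : Icc (0:ℝ) 1 ∈ 𝓝 x := Icc_mem_nhds hx.1 hx.2
    have e2 : derivWithin (derivWithin φ (Icc 0 1)) (Icc 0 1) x = deriv (deriv φ) x := by
      rw [derivWithin_of_mem_nhds hnhds]
      apply Filter.EventuallyEq.deriv_eq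
      filter_upwards [hnhds] with y hy using hd1 y hy
    have := hC x hxI
    simp only [e2, hd1 x hxI, Real.norm_eq_abs] at this
    exact this
  have hbdd : BddAbove ((fun x => |nonlinearity φ x|) '' Icc 0 1) := by
    refine ⟨max C (max |nonlinearity φ 0| |nonlinearity φ 1|), ?_⟩
    rintro _ ⟨x, hx, rfl⟩
    rcases eq_or_lt_of_le hx.1 with h0 | h0
    · subst h0; simp
    rcases eq_or_lt_of_le hx.2 with h1 | h1
    · subst h1; simp
    exact (hN x ⟨h0, h1⟩).trans (le_max_left _ _)
  have hle : ∀ x ∈ Icc (0:ℝ) 1, |nonlinearity φ x| ≤ diffeoNorm φ := fun x hx =>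
    le_csSup hbdd ⟨x, hx, rfl⟩
  refine ⟨fun x hx => (hle x (Ioo_subset_Icc_self hx)).trans hδ.le, ?_⟩
  exact lt_of_le_of_lt ((abs_nonneg _).trans (hle 0 ⟨le_rfl, zero_le_one⟩)) hδ

lemma deriv_distort {φ : ℝ → ℝ} (h : IsSDiffeo φ) {δ : ℝ} (hδ : diffeoNorm φ < δ)
    {x y : ℝ} (hx : x ∈ Ioo (0:ℝ) 1) (hy : y ∈ Ioo (0:ℝ) 1) :
    deriv φ x ≤ Real.exp δ * deriv φ y := by
  obtain ⟨hN, hδ0⟩ := distort_aux h hδ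
  have hpx := h.derivPos x (Ioo_subset_Icc_self hx)
  have hpy := h.derivPos y (Ioo_subset_Icc_self hy)
  have hC : ContDiffOn ℝ 2 (deriv φ) (Ioo 0 1) :=
    (h.contDiff.mono Ioo_subset_Icc_self).deriv_of_isOpen isOpen_Ioo (by norm_num)
  have hdd : ∀ z ∈ Ioo (0:ℝ) 1, HasDerivWithinAt (fun z => Real.log (deriv φ z))
      (nonlinearity φ z) (Ioo 0 1) z := by
    intro z hz
    have h1 : DifferentiableAt ℝ (deriv φ) z :=
      (hC.differentiableOn (by norm_num)).differentiableAt (isOpen_Ioo.mem_nhds hz)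
    exact (h1.hasDerivAt.log (h.derivPos z (Ioo_subset_Icc_self hz)).ne').hasDerivWithinAt
  have key := (convex_Ioo (0:ℝ) 1).norm_image_sub_le_of_norm_hasDerivWithin_le hdd
    (fun z hz => by rw [Real.norm_eq_abs]; exact hN z hz) hy hx
  rw [Real.norm_eq_abs, Real.norm_eq_abs] at key
  have hxy : |x - y| ≤ 1 := by
    rw [abs_le]; constructor <;> linarith [hx.1, hx.2, hy.1, hy.2]
  have : Real.log (deriv φ x) ≤ δ + Real.log (deriv φ y) := by
    have := le_abs_self (Real.log (deriv φ x) - Real.log (deriv φ y))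
    nlinarith
  calc deriv φ x = Real.exp (Real.log (deriv φ x)) := (Real.exp_log hpx).symm
    _ ≤ Real.exp (δ + Real.log (deriv φ y)) := Real.exp_le_exp.2 this
    _ = _ := by rw [Real.exp_add, Real.exp_log hpy]

lemma contOn {φ : ℝ → ℝ} (h : IsSDiffeo φ) : ContinuousOn φ (Icc 0 1) := h.contDiff.continuousOn

lemma mvt {φ : ℝ → ℝ} (h : IsSDiffeo φ) {a b : ℝ} (ha : 0 ≤ a) (hab : a ≤ b) (hb : b ≤ 1) :
    ∃ ξ ∈ Ioo (0:ℝ) 1, φ b - φ a = deriv φ ξ * (b - a) := by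
  rcases hab.eq_or_lt with rfl | hlt
  · exact ⟨1/2, by norm_num, by simp⟩
  obtain ⟨ξ, hξ, e⟩ := exists_deriv_eq_slope φ hlt ((contOn h).mono (Icc_subset_Icc ha hb))
    (fun z hz => (differentiableAt_of_deriv_ne_zero
      (h.derivPos z ⟨by linarith [hz.1], by linarith [hz.2]⟩).ne').differentiableWithinAt)
  refine ⟨ξ, ⟨by linarith [hξ.1], by linarith [hξ.2]⟩, ?_⟩
  rw [e]
  have : b - a ≠ 0 := by linarith
  field_simp

lemma mono {φ : ℝ → ℝ} (h : IsSDiffeo φ) {a b : ℝ} (ha : 0 ≤ a) (hab : a ≤ b) (hb : b ≤ 1) :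
    φ a ≤ φ b := by
  obtain ⟨ξ, hξ, e⟩ := mvt h ha hab hb
  nlinarith [h.derivPos ξ (Ioo_subset_Icc_self hξ)]

lemma distort {φ : ℝ → ℝ} (h : IsSDiffeo φ) {δ : ℝ} (hδ : diffeoNorm φ < δ)
    {a b a' b' : ℝ} (ha : 0 ≤ a) (hab : a ≤ b) (hb : b ≤ 1)
    (ha' : 0 ≤ a') (hab' : a' ≤ b') (hb' : b' ≤ 1) :
    (φ b - φ a) * (b' - a') ≤ Real.exp δ * (φ b' - φ a') * (b - a) := by
  obtain ⟨ξ, hξ, e⟩ := mvt h ha hab hb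
  obtain ⟨η, hη, e'⟩ := mvt h ha' hab' hb'
  have := deriv_distort h hδ hξ hη
  rw [e, e']
  have h0 : 0 ≤ (b - a) * (b' - a') := mul_nonneg (by linarith) (by linarith)
  nlinarith [mul_le_mul_of_nonneg_right this h0]

lemma kappa_ineq {α δ : ℝ} (hα : 1 < α) (hδ : 0 < δ) :
    0 < Real.exp (δ / (α - 1)) * α / (α - 1) ∧
    Real.exp δ * (1 + Real.exp (δ / (α - 1)) * α / (α - 1)) ≤
      (Real.exp (δ / (α - 1)) * α / (α - 1)) ^ α := by
  have hα1 : 0 < α - 1 := by linarith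
  have hα0 : 0 < α := by linarith
  set E := Real.exp (δ / (α - 1)) with hE
  have hE1 : 1 ≤ E := Real.one_le_exp (by positivity)
  have hE0 : 0 < E := by linarith
  set p := α / (α - 1) with hp
  have hp0 : 0 < p := by positivity
  have hk : E * α / (α - 1) = E * p := by rw [hp]; ring
  rw [hk]
  refine ⟨by positivity, ?_⟩
  rw [Real.mul_rpow hE0.le hp0.le]
  have hEα : E ^ α = Real.exp δ * E := by
    rw [hE, ← Real.exp_mul, ← Real.exp_add]
    congr 1
    field_simp
    ring
  have hpα : 1 + p ≤ p ^ α := by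
    have h1 : p ^ α = p * p ^ (α - 1) := by
      rw [← Real.rpow_one_add' hp0.le (by linarith)]
      congr 1; ring
    have hlog : 1 / α ≤ Real.log p := by
      have := Real.one_sub_inv_le_log_of_pos hp0
      have e : 1 - p⁻¹ = 1 / α := by rw [hp]; field_simp; ring
      linarith
    have h2 : 1 + p⁻¹ ≤ p ^ (α - 1) := by
      rw [Real.rpow_def_of_pos hp0]
      have h3 := Real.add_one_le_exp (Real.log p * (α - 1))
      have h4 : p⁻¹ = 1 / α * (α - 1) := by rw [hp]; field_simp
      have h5 := mul_le_mul_of_nonneg_right hlog hα1.le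
      linarith
    rw [h1]
    have := mul_le_mul_of_nonneg_left h2 hp0.le
    have e : p * (1 + p⁻¹) = p + 1 := by field_simp
    linarith
  rw [hEα]
  have hed := Real.exp_pos δ
  have : 1 + E * p ≤ E * p ^ α := by nlinarith
  nlinarith

lemma seq_bound {α δ : ℝ} (hα : 1 < α) (hδ : 0 < δ) {c : ℝ} (hc : c ∈ Ioo (0:ℝ) 1)
    (t : ℕ → ℝ) (h0 : t 0 = 0) (ht : ∀ n, 0 ≤ t n)
    (hstep : ∀ n, t (n+1) ^ α ≤ Real.exp δ * (1 - c + c * t n)) (n : ℕ) :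
    t n ≤ Real.exp (δ / (α - 1)) * α / (α - 1) * (1 - c) ^ ((α ^ n)⁻¹) := by
  obtain ⟨hκ0, hκ⟩ := kappa_ineq hα hδ
  set κ := Real.exp (δ / (α - 1)) * α / (α - 1)
  have hc1 : 0 < 1 - c := by linarith [hc.2]
  have hα0 : 0 < α := by linarith
  induction n with
  | zero => rw [h0]; positivity
  | succ n ih =>
    set s := (1 - c) ^ ((α ^ n)⁻¹) with hs
    have hs0 : 0 < s := by positivity
    have hcs : 1 - c ≤ s := by
      have := Real.rpow_le_rpow_of_exponent_ge hc1 (by linarith [hc.1])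
        (inv_le_one_of_one_le₀ (one_le_pow₀ hα.le (n := n)))
      simpa using this
    have hss : s = ((1 - c) ^ ((α ^ (n+1))⁻¹)) ^ α := by
      rw [hs, ← Real.rpow_mul hc1.le]
      congr 1
      field_simp
      exact pow_succ α n
    have h1 : t (n+1) ^ α ≤ (κ * (1 - c) ^ ((α ^ (n+1))⁻¹)) ^ α := by
      rw [Real.mul_rpow hκ0.le (by positivity), ← hss]
      have h2 : 1 - c + c * t n ≤ (1 + κ) * s := by
        nlinarith [hc.1, hc.2, mul_nonneg hc1.le (ht n)]
      calc _ ≤ _ := hstep n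
        _ ≤ Real.exp δ * ((1 + κ) * s) := by gcongr
        _ = (Real.exp δ * (1 + κ)) * s := by ring
        _ ≤ _ := by gcongr
    exact (Real.rpow_le_rpow_iff (ht _) (by positivity) hα0).1 h1

end CritAux

open CritAux in
lemma left_bound (α : ℝ) (hα : 1 < α) (δ : ℝ)
    (f : LorenzMap α) (hf : f.memL δ) (n : ℕ) :
    f.c - f.fmInv^[n] f.c ≤
      Real.exp (δ / (α - 1)) * α / (α - 1) * f.c * (1 - f.c) ^ ((α ^ n)⁻¹) := by
  have hδ := (distort_aux f.hφ hf.1).2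
  obtain ⟨hc0, hc1⟩ := f.hc
  have hα0 : 0 < α := by linarith
  have hT : ∀ x ∈ Icc 0 f.c, 0 ≤ (f.c - x) / f.c ∧ (f.c - x) / f.c ≤ 1 := fun x hx =>
    ⟨div_nonneg (by linarith [hx.2]) hc0.le, by rw [div_le_one hc0]; linarith [hx.1]⟩
  have hTα : ∀ x ∈ Icc 0 f.c, 0 ≤ |(f.c - x) / f.c| ^ α ∧ |(f.c - x) / f.c| ^ α ≤ 1 := fun x hx => by
    rw [abs_of_nonneg (hT x hx).1]
    exact ⟨Real.rpow_nonneg (hT x hx).1 _, Real.rpow_le_one (hT x hx).1 (hT x hx).2 hα0.le⟩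
  have hq : ∀ x ∈ Icc 0 f.c, qminus α f.u f.c x ∈ Icc (0:ℝ) 1 := fun x hx => by
    obtain ⟨h1, h2⟩ := hTα x hx
    obtain ⟨hu0, hu1⟩ := f.hu
    unfold qminus
    constructor <;> nlinarith
  have hcont : ContinuousOn f.fm (Icc 0 f.c) := by
    refine (contOn f.hφ).comp ?_ hq
    apply Continuous.continuousOn
    unfold qminus
    exact continuous_const.mul (continuous_const.sub
      (((continuous_const.sub continuous_id).div_const _).abs.rpow_const (fun _ => Or.inr hα0.le)))
  have hfm0 : f.fm 0 = 0 := by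
    simp [LorenzMap.fm, qminus, hc0.ne', f.hφ.fix0]
  have hfmc : f.fm f.c = f.φ f.u := by
    simp [LorenzMap.fm, qminus, hα0.ne']
  have hU : f.c < f.φ f.u := by rw [← hfmc]; exact f.hleft f.c ⟨hc0, le_rfl⟩
  have hU1 : f.φ f.u ≤ 1 := by
    have := mono f.hφ f.hu.1 f.hu.2 le_rfl
    rwa [f.hφ.fix1] at this
  have hu0 : 0 < f.u := by
    rcases f.hu.1.eq_or_lt with h | h
    · rw [← h, f.hφ.fix0] at hU; linarith
    · exact h
  have hinv : ∀ y ∈ Icc 0 f.c, f.fmInv y ∈ Icc 0 f.c ∧ f.fm (f.fmInv y) = y := by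
    intro y hy
    have hmem : y ∈ f.fm '' Icc 0 f.c := by
      apply intermediate_value_Icc hc0.le hcont
      rw [hfm0, hfmc]
      exact ⟨hy.1, by linarith [hy.2]⟩
    exact ⟨invFunOn_mem hmem, invFunOn_eq hmem⟩
  have hx : ∀ n, f.fmInv^[n] f.c ∈ Icc 0 f.c := by
    intro n
    induction n with
    | zero => exact ⟨hc0.le, le_rfl⟩
    | succ n ih => rw [iterate_succ_apply']; exact (hinv _ ih).1
  have := seq_bound hα hδ f.hc (fun n => (f.c - f.fmInv^[n] f.c) / f.c) (by simp)
    (fun n => (hT _ (hx n)).1) (by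
      intro n
      obtain ⟨hm, he⟩ := hinv _ (hx n)
      obtain ⟨hx0, hxc⟩ := hx n
      simp only [iterate_succ_apply']
      have e1 : 1 - f.c + f.c * ((f.c - f.fmInv^[n] f.c) / f.c) = 1 - f.fmInv^[n] f.c := by
        field_simp; ring
      rw [e1]
      generalize f.fmInv^[n] f.c = x at *
      generalize f.fmInv x = y at *
      have hq' := hq y hm
      obtain ⟨hA, hB⟩ := hTα y hm
      unfold LorenzMap.fm at he
      unfold qminus at he hq'
      rw [abs_of_nonneg (hT y hm).1] at he hA hB hq'
      set T := ((f.c - y) / f.c) ^ α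
      have hd := distort f.hφ hf.1 le_rfl hu0.le f.hu.2 hq'.1 (by nlinarith) f.hu.2
      rw [he, f.hφ.fix0] at hd
      have hd2 : f.φ f.u * T ≤ Real.exp δ * (f.φ f.u - x) := by
        refine le_of_mul_le_mul_right ?_ hu0
        linarith
      have hd3 : f.φ f.u * T ≤ f.φ f.u * (Real.exp δ * (1 - x)) := by
        have := Real.exp_pos δ
        have h4 : f.φ f.u - x ≤ f.φ f.u * (1 - x) := by nlinarith
        nlinarith
      exact le_of_mul_le_mul_left hd3 (by linarith)) n
  have h2 := mul_le_mul_of_nonneg_right this hc0.le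
  rw [div_mul_cancel₀ _ hc0.ne'] at h2
  linarith

open CritAux in
lemma right_bound (α : ℝ) (hα : 1 < α) (δ : ℝ)
    (f : LorenzMap α) (hf : f.memL δ) (n : ℕ) :
    f.fpInv^[n] f.c - f.c ≤
      Real.exp (δ / (α - 1)) * α / (α - 1) * (1 - f.c) * f.c ^ ((α ^ n)⁻¹) := by
  have hδ := (distort_aux f.hψ hf.2).2
  obtain ⟨hc0, hc1⟩ := f.hc
  have hd0 : 0 < 1 - f.c := by linarith
  have hα0 : 0 < α := by linarith
  have hT : ∀ x ∈ Icc f.c 1, 0 ≤ (x - f.c) / (1 - f.c) ∧ (x - f.c) / (1 - f.c) ≤ 1 := fun x hx =>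
    ⟨div_nonneg (by linarith [hx.1]) hd0.le, by rw [div_le_one hd0]; linarith [hx.2]⟩
  have hTα : ∀ x ∈ Icc f.c 1, 0 ≤ |(x - f.c) / (1 - f.c)| ^ α ∧
      |(x - f.c) / (1 - f.c)| ^ α ≤ 1 := fun x hx => by
    rw [abs_of_nonneg (hT x hx).1]
    exact ⟨Real.rpow_nonneg (hT x hx).1 _, Real.rpow_le_one (hT x hx).1 (hT x hx).2 hα0.le⟩
  have hq : ∀ x ∈ Icc f.c 1, qplus α f.v f.c x ∈ Icc (0:ℝ) 1 := fun x hx => by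
    obtain ⟨h1, h2⟩ := hTα x hx
    obtain ⟨hu0, hu1⟩ := f.hv
    unfold qplus
    constructor <;> nlinarith
  have hcont : ContinuousOn f.fp (Icc f.c 1) := by
    refine (contOn f.hψ).comp ?_ hq
    apply Continuous.continuousOn
    unfold qplus
    exact continuous_const.add (continuous_const.mul (continuous_const.add
      (((continuous_id.sub continuous_const).div_const _).abs.rpow_const (fun _ => Or.inr hα0.le))))
  have hfp1 : f.fp 1 = 1 := by
    simp [LorenzMap.fp, qplus, hd0.ne', f.hψ.fix1]
  have hfpc : f.fp f.c = f.ψ (1 - f.v) := by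
    simp [LorenzMap.fp, qplus, hα0.ne', sub_eq_add_neg]
  have hV : f.ψ (1 - f.v) < f.c := by rw [← hfpc]; exact f.hright f.c ⟨le_rfl, hc1⟩
  have hV1 : 0 ≤ f.ψ (1 - f.v) := by
    have := mono f.hψ le_rfl (show 0 ≤ 1 - f.v by linarith [f.hv.2]) (by linarith [f.hv.1])
    rwa [f.hψ.fix0] at this
  have hv0 : 0 < f.v := by
    rcases f.hv.1.eq_or_lt with h | h
    · rw [← h, sub_zero, f.hψ.fix1] at hV; linarith
    · exact h
  have hv1 := f.hv.2
  have hinv : ∀ y ∈ Icc f.c 1, f.fpInv y ∈ Icc f.c 1 ∧ f.fp (f.fpInv y) = y := by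
    intro y hy
    have hmem : y ∈ f.fp '' Icc f.c 1 := by
      apply intermediate_value_Icc hc1.le hcont
      rw [hfp1, hfpc]
      exact ⟨by linarith [hy.1], hy.2⟩
    exact ⟨invFunOn_mem hmem, invFunOn_eq hmem⟩
  have hx : ∀ n, f.fpInv^[n] f.c ∈ Icc f.c 1 := by
    intro n
    induction n with
    | zero => exact ⟨le_rfl, hc1.le⟩
    | succ n ih => rw [iterate_succ_apply']; exact (hinv _ ih).1
  have := seq_bound hα hδ (c := 1 - f.c) ⟨hd0, by linarith⟩
    (fun n => (f.fpInv^[n] f.c - f.c) / (1 - f.c)) (by simp)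
    (fun n => (hT _ (hx n)).1) (by
      intro n
      obtain ⟨hm, he⟩ := hinv _ (hx n)
      obtain ⟨hxc, hx1⟩ := hx n
      simp only [iterate_succ_apply']
      have e1 : 1 - (1 - f.c) + (1 - f.c) * ((f.fpInv^[n] f.c - f.c) / (1 - f.c))
          = f.fpInv^[n] f.c := by
        rw [mul_div_cancel₀ _ hd0.ne']; ring
      rw [e1]
      generalize f.fpInv^[n] f.c = x at *
      generalize f.fpInv x = y at *
      have hq' := hq y hm
      obtain ⟨hA, hB⟩ := hTα y hm
      unfold LorenzMap.fp at he
      unfold qplus at he hq'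
      rw [abs_of_nonneg (hT y hm).1] at he hA hB hq'
      set T := ((y - f.c) / (1 - f.c)) ^ α
      have hd := distort f.hψ hf.2 (a := 1 - f.v) (b := 1) (a' := 1 - f.v)
        (by linarith) (by linarith) le_rfl (by linarith) (by nlinarith) hq'.2
      rw [he, f.hψ.fix1] at hd
      have hd2 : (1 - f.ψ (1 - f.v)) * T ≤ Real.exp δ * (x - f.ψ (1 - f.v)) := by
        refine le_of_mul_le_mul_right ?_ hv0
        linarith
      have hd3 : (1 - f.ψ (1 - f.v)) * T ≤ (1 - f.ψ (1 - f.v)) * (Real.exp δ * x) := by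
        have := Real.exp_pos δ
        have h4 : x - f.ψ (1 - f.v) ≤ (1 - f.ψ (1 - f.v)) * x := by nlinarith
        nlinarith
      exact le_of_mul_le_mul_left hd3 (by linarith)) n
  have h2 := mul_le_mul_of_nonneg_right this hd0.le
  rw [div_mul_cancel₀ _ hd0.ne', sub_sub_cancel] at h2
  linarith

/-- **Critical preimage upper bounds.** Let `κ = e^(δ/(α-1)) α/(α-1)` and
`αₙ = α^(-n)`. If `f ∈ L_δ`, then for every `n ≥ 1`:
`c - f₋⁻ⁿ(c) ≤ κ c (1-c)^(αₙ)` and `f₊⁻ⁿ(c) - c ≤ κ (1-c) c^(αₙ)`. -/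
theorem critical_preimage_upper_bounds (α : ℝ) (hα : 1 < α) (δ : ℝ)
    (f : LorenzMap α) (hf : f.memL δ) (n : ℕ) (hn : 1 ≤ n) :
    f.c - f.fmInv^[n] f.c ≤
      Real.exp (δ / (α - 1)) * α / (α - 1) * f.c * (1 - f.c) ^ ((α ^ n)⁻¹) ∧
    f.fpInv^[n] f.c - f.c ≤
      Real.exp (δ / (α - 1)) * α / (α - 1) * (1 - f.c) * f.c ^ ((α ^ n)⁻¹) := by
  exact ⟨left_bound α hα δ f hf n, right_bound α hα δ f hf n⟩
end
end

section
/- (Size of C, bounded critical point) For every closed interval Δ ⊂ (0,1) and every δ < (log α)/2 there exist N < ∞, K < ∞ and λ > 1 such that: if f ∈ L_δ is an (a,b)-renormalizable Lorenz map with min{a,b} ≥ N and critical point c ∈ Δ, then the return interval C satisfies |C| ≤ K · min{c − f_-^{−1}(c), f_+^{−1}(c) − c} · λ^{−min{a,b}/α}. -/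
open Set Filter Topology MeasureTheory Function

noncomputable section

/-- Bounded mean-derivative ratio for a homeomorphism of `[0,1]`. -/
structure DistProp (E : ℝ) (ψ : ℝ → ℝ) : Prop where
  cont : ContinuousOn ψ (Icc 0 1)
  zero : ψ 0 = 0
  one : ψ 1 = 1
  dist : ∀ x y z w, 0 ≤ x → x ≤ y → y ≤ 1 → 0 ≤ z → z ≤ w → w ≤ 1 →
    (ψ y - ψ x) * (w - z) ≤ E * ((ψ w - ψ z) * (y - x))

lemma DistProp.reflect {E : ℝ} {ψ : ℝ → ℝ} (h : DistProp E ψ) :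
    DistProp E (fun y => 1 - ψ (1 - y)) := by
  refine ⟨?_, ?_, ?_, ?_⟩
  · refine continuousOn_const.sub (h.cont.comp (by fun_prop) ?_)
    intro x hx
    exact ⟨by linarith [hx.2], by linarith [hx.1]⟩
  · simp [h.one]
  · simp [h.zero]
  · intro x y z w h1 h2 h3 h4 h5 h6
    have := h.dist (1 - y) (1 - x) (1 - w) (1 - z) (by linarith) (by linarith) (by linarith)
      (by linarith) (by linarith) (by linarith)
    have e1 : (1 - z) - (1 - w) = w - z := by ring
    have e2 : (1 - x) - (1 - y) = y - x := by ring
    rw [e1, e2] at this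
    have e3 : (1 - ψ (1 - y)) - (1 - ψ (1 - x)) = ψ (1 - x) - ψ (1 - y) := by ring
    have e4 : (1 - ψ (1 - w)) - (1 - ψ (1 - z)) = ψ (1 - z) - ψ (1 - w) := by ring
    simp only [e3, e4]
    exact this

lemma DistProp.lower {E : ℝ} {ψ : ℝ → ℝ} (h : DistProp E ψ) {x y : ℝ} (h1 : 0 ≤ x) (h2 : x ≤ y)
    (h3 : y ≤ 1) : y - x ≤ E * (ψ y - ψ x) := by
  have := h.dist 0 1 x y le_rfl zero_le_one le_rfl h1 h2 h3
  rw [h.zero, h.one] at this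
  linarith

lemma DistProp.upper {E : ℝ} {ψ : ℝ → ℝ} (h : DistProp E ψ) {x y : ℝ} (h1 : 0 ≤ x) (h2 : x ≤ y)
    (h3 : y ≤ 1) : ψ y - ψ x ≤ E * (y - x) := by
  have := h.dist x y 0 1 h1 h2 h3 le_rfl zero_le_one le_rfl
  rw [h.zero, h.one] at this
  linarith

lemma DistProp.strict {E : ℝ} (hE : 0 < E) {ψ : ℝ → ℝ} (h : DistProp E ψ) {x y : ℝ} (h1 : 0 ≤ x)
    (h2 : x < y) (h3 : y ≤ 1) : ψ x < ψ y := by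
  have := h.lower h1 h2.le h3
  by_contra hc
  push Not at hc
  nlinarith

lemma DistProp.mono {E : ℝ} (hE : 0 < E) {ψ : ℝ → ℝ} (h : DistProp E ψ) {x y : ℝ} (h1 : 0 ≤ x)
    (h2 : x ≤ y) (h3 : y ≤ 1) : ψ x ≤ ψ y := by
  rcases h2.eq_or_lt with rfl | h2
  · exact le_rfl
  · exact (h.strict hE h1 h2 h3).le

/-- The distortion estimate coming from the bound on the nonlinearity. -/
lemma distProp_of_norm {φ : ℝ → ℝ} (h : IsSDiffeo φ) {δ : ℝ} (hn : diffeoNorm φ < δ) :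
    0 < δ ∧ DistProp (Real.exp δ) φ := by
  have hU : UniqueDiffOn ℝ (Icc (0:ℝ) 1) := uniqueDiffOn_Icc zero_lt_one
  set g1 := derivWithin φ (Icc 0 1) with hg1
  set g2 := derivWithin g1 (Icc 0 1) with hg2
  have c1 : ContDiffOn ℝ 2 g1 (Icc 0 1) := h.contDiff.derivWithin hU (by norm_num)
  have c2 : ContDiffOn ℝ 1 g2 (Icc 0 1) := c1.derivWithin hU (by norm_num)
  have nh : ∀ x ∈ Ioo (0:ℝ) 1, Icc (0:ℝ) 1 ∈ 𝓝 x := fun x hx => Icc_mem_nhds hx.1 hx.2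
  have e1 : ∀ x ∈ Icc (0:ℝ) 1, deriv φ x = g1 x := by
    intro x hx
    have hd : DifferentiableAt ℝ φ x := differentiableAt_of_deriv_ne_zero (h.derivPos x hx).ne'
    exact (hd.derivWithin (hU x hx)).symm
  have e1' : ∀ x ∈ Ioo (0:ℝ) 1, deriv φ =ᶠ[𝓝 x] g1 := by
    intro x hx
    filter_upwards [nh x hx] with y hy using e1 y hy
  have e2 : ∀ x ∈ Ioo (0:ℝ) 1, deriv (deriv φ) x = g2 x := by
    intro x hx
    rw [(e1' x hx).deriv_eq, hg2, derivWithin_of_mem_nhds (nh x hx)]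
  have pos1 : ∀ x ∈ Icc (0:ℝ) 1, 0 < g1 x := fun x hx => e1 x hx ▸ h.derivPos x hx
  have hc : ContinuousOn (fun x => |g2 x / g1 x|) (Icc 0 1) :=
    (c2.continuousOn.div c1.continuousOn (fun x hx => (pos1 x hx).ne')).abs
  obtain ⟨M, hM⟩ := isCompact_Icc.bddAbove_image hc
  have bdd : BddAbove ((fun x => |nonlinearity φ x|) '' Icc 0 1) := by
    refine ⟨max M (max |nonlinearity φ 0| |nonlinearity φ 1|), ?_⟩
    rintro _ ⟨x, hx, rfl⟩
    rcases hx.1.eq_or_lt with h0 | h0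
    · subst h0; simp
    rcases hx.2.eq_or_lt with h1 | h1
    · subst h1; simp
    · refine le_trans ?_ (le_max_left _ _)
      have := hM (mem_image_of_mem _ hx)
      simpa [nonlinearity, e2 x ⟨h0, h1⟩, e1 x hx] using this
  have hN : ∀ x ∈ Icc (0:ℝ) 1, |nonlinearity φ x| < δ := fun x hx =>
    lt_of_le_of_lt (le_csSup bdd (mem_image_of_mem _ hx)) hn
  have hδ : 0 < δ := lt_of_le_of_lt (abs_nonneg _) (hN 0 (by simp))
  have hdl : ∀ x ∈ Ioo (0:ℝ) 1,
      HasDerivAt (fun y => Real.log (deriv φ y)) (nonlinearity φ x) x := by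
    intro x hx
    have hx' := Ioo_subset_Icc_self hx
    have hd : DifferentiableAt ℝ (deriv φ) x := by
      have : DifferentiableAt ℝ g1 x :=
        ((c1.differentiableOn (by norm_num)) x hx').differentiableAt (nh x hx)
      exact this.congr_of_eventuallyEq (e1' x hx)
    exact hd.hasDerivAt.log (h.derivPos x hx').ne'
  have hlip : ∀ x ∈ Ioo (0:ℝ) 1, ∀ y ∈ Ioo (0:ℝ) 1,
      Real.log (deriv φ x) - Real.log (deriv φ y) ≤ δ := by
    intro x hx y hy
    have := Convex.norm_image_sub_le_of_norm_hasDerivWithin_le (C := δ)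
      (fun z hz => (hdl z hz).hasDerivWithinAt)
      (fun z hz => (hN z (Ioo_subset_Icc_self hz)).le) (convex_Ioo (0:ℝ) 1) hy hx
    rw [Real.norm_eq_abs, Real.norm_eq_abs] at this
    have h3 : |x - y| ≤ 1 := by
      rw [abs_le]; constructor <;> linarith [hx.1, hx.2, hy.1, hy.2]
    have h4 := le_abs_self (Real.log (deriv φ x) - Real.log (deriv φ y))
    nlinarith
  have hder : ∀ x ∈ Ioo (0:ℝ) 1, ∀ y ∈ Ioo (0:ℝ) 1, deriv φ x ≤ Real.exp δ * deriv φ y := by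
    intro x hx y hy
    have p1 := h.derivPos x (Ioo_subset_Icc_self hx)
    have p2 := h.derivPos y (Ioo_subset_Icc_self hy)
    rw [← Real.exp_log p1, ← Real.exp_log p2, ← Real.exp_add]
    exact Real.exp_le_exp.2 (by linarith [hlip x hx y hy])
  refine ⟨hδ, h.contDiff.continuousOn, h.fix0, h.fix1, ?_⟩
  intro x y z w h1 h2 h3 h4 h5 h6
  rcases h2.eq_or_lt with rfl | h2
  · simp
  rcases h5.eq_or_lt with rfl | h5
  · simp
  have mvt : ∀ x y : ℝ, 0 ≤ x → x < y → y ≤ 1 →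
      ∃ ξ ∈ Ioo (0:ℝ) 1, φ y - φ x = deriv φ ξ * (y - x) := by
    intro x y h1 h2 h3
    obtain ⟨ξ, hξ, hh⟩ := exists_deriv_eq_slope φ h2
      (h.contDiff.continuousOn.mono (Icc_subset_Icc h1 h3))
      (fun z hz => (differentiableAt_of_deriv_ne_zero (h.derivPos z
        ⟨h1.trans hz.1.le, hz.2.le.trans h3⟩).ne').differentiableWithinAt)
    refine ⟨ξ, ⟨lt_of_le_of_lt h1 hξ.1, lt_of_lt_of_le hξ.2 h3⟩, ?_⟩
    rw [hh, div_mul_cancel₀ _ (by linarith)]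
  obtain ⟨ξ, hξ, e3⟩ := mvt x y h1 h2 h3
  obtain ⟨η, hη, e4⟩ := mvt z w h4 h5 h6
  rw [e3, e4]
  have := hder ξ hξ η hη
  have hp : 0 ≤ (y - x) * (w - z) := mul_nonneg (by linarith) (by linarith)
  nlinarith [mul_le_mul_of_nonneg_right this hp]

/-- Data of a right branch `ψ ∘ q₊`. -/
structure RB (α E : ℝ) (ψ : ℝ → ℝ) (v c : ℝ) : Prop where
  hα : 1 < α
  hE : 0 < E
  hd : DistProp E ψ
  v0 : 0 ≤ v
  v1 : v ≤ 1
  c0 : 0 < c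
  c1 : c < 1
  below : ψ (1 - v) < c

namespace RB
variable {α E v c : ℝ} {ψ : ℝ → ℝ}

lemma vpos (h : RB α E ψ v c) : 0 < v := by
  rcases h.v0.eq_or_lt with h0 | h0
  · have := h.below
    rw [← h0, sub_zero, h.hd.one] at this
    linarith [h.c1]
  · exact h0

lemma tmem (h : RB α E ψ v c) {x : ℝ} (hx : x ∈ Icc c 1) :
    0 ≤ (x - c) / (1 - c) ∧ (x - c) / (1 - c) ≤ 1 := by
  have := h.c1
  refine ⟨div_nonneg (by linarith [hx.1]) (by linarith), ?_⟩
  rw [div_le_one (by linarith)]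
  linarith [hx.2]

lemma q_eq (h : RB α E ψ v c) {x : ℝ} (hx : x ∈ Icc c 1) :
    qplus α v c x = 1 - v + v * ((x - c) / (1 - c)) ^ α := by
  unfold qplus
  rw [abs_of_nonneg (h.tmem hx).1]
  ring

lemma q_mem (h : RB α E ψ v c) {x : ℝ} (hx : x ∈ Icc c 1) :
    1 - v ≤ qplus α v c x ∧ qplus α v c x ≤ 1 := by
  rw [h.q_eq hx]
  obtain ⟨h0, h1⟩ := h.tmem hx
  have := Real.rpow_nonneg h0 α
  have := Real.rpow_le_one h0 h1 (by linarith [h.hα] : 0 ≤ α)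
  have := h.v0
  constructor <;> nlinarith

lemma q_c (h : RB α E ψ v c) : qplus α v c c = 1 - v := by
  rw [h.q_eq ⟨le_rfl, h.c1.le⟩, sub_self, zero_div, Real.zero_rpow (by linarith [h.hα])]
  ring

lemma q_one (h : RB α E ψ v c) : qplus α v c 1 = 1 := by
  have := h.c1
  rw [h.q_eq ⟨h.c1.le, le_rfl⟩, div_self (by linarith), Real.one_rpow]
  ring

lemma q_strict (h : RB α E ψ v c) {x y : ℝ} (h1 : c ≤ x) (h2 : x < y) (h3 : y ≤ 1) :
    qplus α v c x < qplus α v c y := by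
  have hx : x ∈ Icc c 1 := ⟨h1, by linarith⟩
  rw [h.q_eq hx, h.q_eq ⟨by linarith, h3⟩]
  have hc := h.c1
  have : ((x - c) / (1 - c)) ^ α < ((y - c) / (1 - c)) ^ α := by
    apply Real.rpow_lt_rpow (h.tmem hx).1 _ (by linarith [h.hα])
    apply div_lt_div_of_pos_right (by linarith) (by linarith)
  nlinarith [h.vpos]

lemma F_strict (h : RB α E ψ v c) {x y : ℝ} (h1 : c ≤ x) (h2 : x < y) (h3 : y ≤ 1) :
    ψ (qplus α v c x) < ψ (qplus α v c y) := by
  have := (h.q_mem ⟨h1, by linarith⟩).1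
  exact h.hd.strict h.hE (by linarith [h.v1]) (h.q_strict h1 h2 h3)
    (h.q_mem ⟨by linarith, h3⟩).2

lemma F_one (h : RB α E ψ v c) : ψ (qplus α v c 1) = 1 := by rw [h.q_one, h.hd.one]

lemma F_le_one (h : RB α E ψ v c) {x : ℝ} (hx : x ∈ Icc c 1) : ψ (qplus α v c x) ≤ 1 := by
  have := h.hd.mono h.hE (by linarith [h.v1, (h.q_mem hx).1]) (h.q_mem hx).2 le_rfl
  rwa [h.hd.one] at this

lemma F_nonneg (h : RB α E ψ v c) {x : ℝ} (hx : x ∈ Icc c 1) : 0 ≤ ψ (qplus α v c x) := by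
  have := h.hd.mono h.hE le_rfl (by linarith [h.v1, (h.q_mem hx).1]) (h.q_mem hx).2
  rwa [h.hd.zero] at this

lemma exists_q (h : RB α E ψ v c) : ∃ q ∈ Icc c 1, ψ (qplus α v c q) = c := by
  have hcont : ContinuousOn (fun x => ψ (qplus α v c x)) (Icc c 1) := by
    refine h.hd.cont.comp ?_ ?_
    · unfold qplus
      have : Continuous fun x : ℝ => 1 + v * (-1 + |(x - c) / (1 - c)| ^ α) := by
        have : Continuous fun x : ℝ => |(x - c) / (1 - c)| ^ α :=
          Continuous.rpow_const (by fun_prop) (fun x => Or.inr (by linarith [h.hα]))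
        fun_prop
      exact this.continuousOn
    · intro x hx
      exact ⟨by linarith [h.v1, (h.q_mem hx).1], (h.q_mem hx).2⟩
  have := intermediate_value_Icc h.c1.le hcont
  have hm : c ∈ Icc (ψ (qplus α v c c)) (ψ (qplus α v c 1)) := by
    rw [h.F_one, h.q_c]
    exact ⟨h.below.le, h.c1.le⟩
  obtain ⟨q, hq, e⟩ := this hm
  exact ⟨q, hq, e⟩

/-- `F x - F c ≤ E t^α`. -/
lemma upper (h : RB α E ψ v c) {x : ℝ} (hx : x ∈ Icc c 1) :
    ψ (qplus α v c x) - ψ (qplus α v c c) ≤ E * ((x - c) / (1 - c)) ^ α := by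
  have h1 := h.q_mem hx
  have := h.hd.upper (x := qplus α v c c) (y := qplus α v c x)
    (by rw [h.q_c]; linarith [h.v1]) (by rw [h.q_c]; exact h1.1) h1.2
  refine this.trans ?_
  rw [h.q_c, h.q_eq hx]
  have ht := Real.rpow_nonneg (h.tmem hx).1 α
  apply mul_le_mul_of_nonneg_left _ h.hE.le
  nlinarith [h.v1]

/-- `(1-c) t^α ≤ E² (F x - F c)`. -/
lemma lower (h : RB α E ψ v c) {x : ℝ} (hx : x ∈ Icc c 1) :
    (1 - c) * ((x - c) / (1 - c)) ^ α ≤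
      E ^ 2 * (ψ (qplus α v c x) - ψ (qplus α v c c)) := by
  have h1 := h.q_mem hx
  have h2 := h.hd.lower (x := qplus α v c c) (y := qplus α v c x)
    (by rw [h.q_c]; linarith [h.v1]) (by rw [h.q_c]; exact h1.1) h1.2
  have h3 := h.hd.upper (x := 1 - v) (y := 1) (by linarith [h.v1]) (by linarith [h.v0]) le_rfl
  rw [h.hd.one] at h3
  have h4 := h.below
  have h5 : 1 - c ≤ E * v := by linarith
  have ht := Real.rpow_nonneg (h.tmem hx).1 α
  have h6 : v * ((x - c) / (1 - c)) ^ α = qplus α v c x - qplus α v c c := by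
    rw [h.q_c, h.q_eq hx]; ring
  calc (1 - c) * ((x - c) / (1 - c)) ^ α ≤ (E * v) * ((x - c) / (1 - c)) ^ α :=
        mul_le_mul_of_nonneg_right h5 ht
    _ = E * (qplus α v c x - qplus α v c c) := by rw [← h6]; ring
    _ ≤ E * (E * (ψ (qplus α v c x) - ψ (qplus α v c c))) :=
        mul_le_mul_of_nonneg_left h2 h.hE.le
    _ = _ := by ring

/-- Uniform expansion away from the critical point. -/
lemma expand (h : RB α E ψ v c) {t1 μ lam τ : ℝ} (ht0 : 0 < t1) (ht1 : t1 < 1)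
    (hκ : E * t1 ^ (α - 1) < 1) (hμ : E * μ * (1 - t1) ≤ 1 - t1 ^ α)
    (hτ : 0 ≤ τ) (hl1 : lam ≤ μ) (hl2 : lam ≤ 1 + (1 - E * t1 ^ (α - 1)) * τ)
    {x : ℝ} (hx : x ∈ Icc c 1) (hxτ : τ ≤ (x - c) / (1 - c)) :
    lam * (1 - x) ≤ 1 - ψ (qplus α v c x) := by
  obtain ⟨h0, h1⟩ := h.tmem hx
  have hc := h.c1
  have hxt : 1 - x = (1 - c) * (1 - (x - c) / (1 - c)) := by
    field_simp [show (1 - c) ≠ 0 by linarith]; ring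
  have hqm := h.q_mem hx
  have hq := h.q_eq hx
  have hE := h.hE
  have hv := h.vpos
  have hw := h.below
  generalize hF : ψ (qplus α v c x) = F
  generalize hW : ψ (1 - v) = w at hw
  set t := (x - c) / (1 - c) with ht
  rw [hxt]
  have hta := Real.rpow_nonneg h0 α
  rcases le_total t1 t with htt | htt
  · have d1 := h.hd.dist (1 - v) 1 (qplus α v c x) 1 (by linarith [h.v1]) (by linarith) le_rfl
      (by linarith [h.v1]) hqm.2 le_rfl
    rw [h.hd.one, hF, hW, hq] at d1
    have d2 : (1 - w) * (1 - t ^ α) ≤ E * (1 - F) := by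
      have : v * ((1 - w) * (1 - t ^ α)) ≤ v * (E * (1 - F)) := by linarith
      exact le_of_mul_le_mul_left this hv
    have hta1 := Real.rpow_le_one h0 h1 (by linarith [h.hα] : 0 ≤ α)
    have d3 : (1 - c) * (1 - t ^ α) ≤ E * (1 - F) := by nlinarith
    have d4 : E * μ * (1 - t) ≤ 1 - t ^ α := by
      rcases h1.eq_or_lt with h1 | h1
      · rw [h1]; simp
      have hconv := convexOn_rpow h.hα.le
      have := hconv.secant_mono (a := 1) (x := t1) (y := t) (by simp) ht0.le h0 (by linarith)
        (by linarith) htt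
      rw [Real.one_rpow] at this
      have e1 : (t1 ^ α - 1) / (t1 - 1) = (1 - t1 ^ α) / (1 - t1) := by
        rw [← neg_sub, ← neg_sub 1 t1, neg_div_neg_eq]
      have e2 : (t ^ α - 1) / (t - 1) = (1 - t ^ α) / (1 - t) := by
        rw [← neg_sub, ← neg_sub 1 t, neg_div_neg_eq]
      rw [e1, e2] at this
      have h7 : E * μ ≤ (1 - t1 ^ α) / (1 - t1) := by
        rwa [le_div_iff₀ (by linarith)]
      have := h7.trans this
      rwa [le_div_iff₀ (by linarith)] at this
    have d5 : E * (μ * ((1 - c) * (1 - t))) ≤ E * (1 - F) := by nlinarith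
    have d6 := le_of_mul_le_mul_left d5 hE
    have : 0 ≤ (1 - c) * (1 - t) := mul_nonneg (by linarith) (by linarith)
    nlinarith
  · have d1 := h.hd.dist (1 - v) (qplus α v c x) (1 - v) 1 (by linarith [h.v1]) hqm.1 hqm.2
      (by linarith [h.v1]) (by linarith) le_rfl
    rw [h.hd.one, hF, hW, hq] at d1
    have d2 : F - w ≤ E * (1 - w) * t ^ α := by
      have : v * (F - w) ≤ v * (E * (1 - w) * t ^ α) := by linarith
      exact le_of_mul_le_mul_left this hv
    have d3 : E * t ^ α ≤ E * t1 ^ (α - 1) * t := by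
      have : t ^ α = t ^ (α - 1) * t := by
        rcases h0.eq_or_lt with h0 | h0
        · rw [← h0, Real.zero_rpow (by linarith [h.hα])]; simp
        · rw [← Real.rpow_add_one h0.ne']; simp
      rw [this, mul_assoc]
      apply mul_le_mul_of_nonneg_left _ hE.le
      exact mul_le_mul_of_nonneg_right
        (Real.rpow_le_rpow h0 htt (by linarith [h.hα])) h0
    generalize E * t1 ^ (α - 1) = κ at *
    have d4 : κ * t ≤ 1 := by nlinarith
    have d5 : (1 - c) * (1 - κ * t) ≤ 1 - F := by nlinarith
    have d6 : lam * (1 - t) ≤ 1 - κ * t := by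
      have g1 : lam * (1 - t) ≤ (1 + (1 - κ) * τ) * (1 - t) :=
        mul_le_mul_of_nonneg_right hl2 (by linarith)
      have g2 : (1 - κ) * τ * (1 - t) ≤ (1 - κ) * t := by
        have : 0 ≤ 1 - κ := by linarith
        have g3 : τ * (1 - t) ≤ t := by nlinarith
        nlinarith
      nlinarith
    nlinarith

lemma orbit (h : RB α E ψ v c) {lam q : ℝ} (hl : 0 ≤ lam) (hq : q ∈ Icc c 1)
    (hqc : ψ (qplus α v c q) = c)
    (hexp : ∀ x ∈ Icc q 1, lam * (1 - x) ≤ 1 - ψ (qplus α v c x))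
    (y : ℕ → ℝ) (n : ℕ) (h0 : y 0 ≤ 1) (hs : ∀ i < n, y (i + 1) = ψ (qplus α v c (y i)))
    (hc : ∀ i ≤ n, c < y i) : lam ^ n * (1 - y 0) ≤ 1 := by
  have key : ∀ i ≤ n, y i ≤ 1 ∧ lam ^ i * (1 - y 0) ≤ 1 - y i := by
    intro i
    induction i with
    | zero => intro _; simp [h0]
    | succ i ih =>
      intro hi
      obtain ⟨i1, i2⟩ := ih (by omega)
      have hci := hc i (by omega)
      have hmem : y i ∈ Icc c 1 := ⟨hci.le, i1⟩
      rw [hs i (by omega)]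
      refine ⟨h.F_le_one hmem, ?_⟩
      have hqy : q ≤ y i := by
        by_contra hlt
        push Not at hlt
        have := h.F_strict hci.le hlt hq.2
        rw [hqc, ← hs i (by omega)] at this
        linarith [hc (i + 1) hi]
      have := hexp (y i) ⟨hqy, i1⟩
      calc lam ^ (i + 1) * (1 - y 0) = lam * (lam ^ i * (1 - y 0)) := by ring
        _ ≤ lam * (1 - y i) := mul_le_mul_of_nonneg_left i2 hl
        _ ≤ _ := this
  have := (key n le_rfl).2
  linarith [hc n le_rfl, h.c0]

end RB

lemma consts {α δ : ℝ} (hα : 1 < α) (hδ : δ < Real.log α / 2) :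
    ∃ t1 μ : ℝ, 0 < t1 ∧ t1 < 1 ∧ Real.exp δ * t1 ^ (α - 1) < 1 ∧ 1 < μ ∧
      Real.exp δ * μ * (1 - t1) ≤ 1 - t1 ^ α := by
  set s := Real.exp (Real.log α / 2) with hs
  have hlog : 0 < Real.log α := Real.log_pos hα
  have hs1 : 1 < s := Real.one_lt_exp_iff.2 (by linarith)
  have hss : s * s = α := by
    rw [hs, ← Real.exp_add, add_halves, Real.exp_log (by linarith)]
  have hEs : Real.exp δ < s := Real.exp_lt_exp.2 hδ
  have hls : Real.log s = Real.log α / 2 := Real.log_exp _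
  set t1 := Real.exp (-(Real.log s / (α - 1))) with ht1
  have ht0 : 0 < t1 := Real.exp_pos _
  have hq : 0 < Real.log s / (α - 1) := div_pos (by linarith) (by linarith)
  have ht1' : t1 < 1 := Real.exp_lt_one_iff.2 (by linarith)
  have hp : t1 ^ (α - 1) = s⁻¹ := by
    rw [ht1, ← Real.exp_mul, neg_mul, div_mul_cancel₀ _ (by linarith : α - 1 ≠ 0), Real.exp_neg,
      Real.exp_log (by linarith)]
  have hpa : t1 ^ α = s⁻¹ * t1 := by
    rw [← hp, ← Real.rpow_add_one ht0.ne']; simp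
  have hs0 : 0 < s := by linarith
  have hge : s / (s + 1) ≤ t1 := by
    have h1 : Real.log s / (α - 1) ≤ 1 / (s + 1) := by
      rw [div_le_div_iff₀ (by linarith) (by linarith)]
      have := Real.log_le_sub_one_of_pos hs0
      nlinarith
    have h2 := Real.add_one_le_exp (-(Real.log s / (α - 1)))
    have h3 : s / (s + 1) = 1 - 1 / (s + 1) := by field_simp; ring
    rw [h3]; linarith
  have hge' : s ≤ t1 * (s + 1) := by rwa [div_le_iff₀ (by linarith)] at hge
  refine ⟨t1, s / Real.exp δ, ht0, ht1', ?_, ?_, ?_⟩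
  · rw [hp, ← div_eq_mul_inv, div_lt_one hs0]; exact hEs
  · rw [lt_div_iff₀ (Real.exp_pos _)]; linarith
  · rw [mul_div_cancel₀ _ (Real.exp_pos δ).ne', hpa]
    have : s * (s * (1 - t1)) ≤ s * (1 - s⁻¹ * t1) := by
      have e : s * (1 - s⁻¹ * t1) = s - t1 := by field_simp
      rw [e]
      nlinarith
    exact le_of_mul_le_mul_left this hs0

lemma tau_aux {α B τ : ℝ} (hα : 1 < α) (hB : 0 < B) (hτ : 0 < τ) (h : τ ≤ B * τ ^ α) :
    B ^ (-(1 / (α - 1))) ≤ τ := by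
  have h1 : τ ^ α = τ ^ (α - 1) * τ := by
    rw [← Real.rpow_add_one hτ.ne']; simp
  have h2 : B⁻¹ ≤ τ ^ (α - 1) := by
    rw [h1] at h
    rw [inv_le_iff_one_le_mul₀ hB]
    by_contra hc
    push Not at hc
    nlinarith
  have h3 := Real.rpow_le_rpow (by positivity) h2 (by
    apply one_div_nonneg.2; linarith : 0 ≤ 1 / (α - 1))
  rw [← Real.rpow_mul hτ.le, mul_one_div_cancel (by linarith), Real.rpow_one,
    Real.inv_rpow hB.le, ← Real.rpow_neg hB.le] at h3
  exact h3

lemma tau_bound {α B τ σ : ℝ} (hα : 1 < α) (hB : 0 < B) (hτ : 0 < τ) (hσ : 0 < σ)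
    (h1 : σ ≤ B * τ ^ α) (h2 : τ ≤ B * σ ^ α) :
    B ^ (-(1 / (α - 1))) ≤ τ ∧ B ^ (-(1 / (α - 1))) ≤ σ := by
  rcases le_total τ σ with h | h
  · have := tau_aux hα hB hτ (h.trans h1)
    exact ⟨this, this.trans h⟩
  · have := tau_aux hα hB hσ (h.trans h2)
    exact ⟨this.trans h, this⟩

lemma RB.size {α E v c d lam x : ℝ} {ψ : ℝ → ℝ} (h : RB α E ψ v c) (hd : 0 < d) (hdc : d ≤ 1 - c)
    (hl : 1 < lam) (n m : ℕ) (hm : m ≤ n + 1) (hx : x ∈ Icc c 1)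
    (hF : lam ^ n * ψ (qplus α v c x) ≤ 1) :
    x - c ≤ (E ^ 2 * lam / d) ^ (1 / α) * lam ^ (-(m : ℝ) / α) := by
  have hc := h.c1
  have hc0 := h.c0
  have hE := h.hE
  have hα := h.hα
  obtain ⟨h0, h1⟩ := h.tmem hx
  have hlow := h.lower hx
  have hF0 := h.F_nonneg (x := c) ⟨le_rfl, hc.le⟩
  have hxt : x - c ≤ (x - c) / (1 - c) := by
    rw [le_div_iff₀ (by linarith)]
    nlinarith [hx.1]
  refine hxt.trans ?_
  set t := (x - c) / (1 - c)
  have hta := Real.rpow_nonneg h0 α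
  have hlp : 0 < lam := by linarith
  have g1 : d * t ^ α ≤ E ^ 2 * ψ (qplus α v c x) := by
    have : 0 < E ^ 2 := by positivity
    nlinarith
  have g2 : lam ^ m ≤ lam ^ (n + 1) := pow_le_pow_right₀ hl.le hm
  have g3 : lam ^ m * (d * t ^ α) ≤ E ^ 2 * lam := by
    calc lam ^ m * (d * t ^ α) ≤ lam ^ (n + 1) * (d * t ^ α) := by gcongr
      _ ≤ lam ^ (n + 1) * (E ^ 2 * ψ (qplus α v c x)) := by gcongr
      _ = E ^ 2 * lam * (lam ^ n * ψ (qplus α v c x)) := by ring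
      _ ≤ E ^ 2 * lam * 1 := by gcongr
      _ = _ := by ring
  have g4 : t ^ α ≤ E ^ 2 * lam / d * lam ^ (-(m : ℝ)) := by
    rw [Real.rpow_neg hlp.le, Real.rpow_natCast, ← div_eq_mul_inv, le_div_iff₀ (by positivity),
      le_div_iff₀ hd]
    linarith
  have g5 := Real.rpow_le_rpow hta g4 (by positivity : 0 ≤ 1 / α)
  rw [← Real.rpow_mul h0, mul_one_div_cancel (by linarith), Real.rpow_one,
    Real.mul_rpow (by positivity) (by positivity), ← Real.rpow_mul hlp.le, mul_one_div] at g5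
  exact g5

lemma fm_reflect {α : ℝ} (f : LorenzMap α) (x : ℝ) :
    (fun y => 1 - f.φ (1 - y)) (qplus α f.u (1 - f.c) (1 - x)) = 1 - f.fm x := by
  have : 1 - qplus α f.u (1 - f.c) (1 - x) = qminus α f.u f.c x := by
    unfold qplus qminus
    have e : (1 - x - (1 - f.c)) / (1 - (1 - f.c)) = (f.c - x) / f.c := by
      congr 1 <;> ring
    rw [e]; ring
  simp only [this, LorenzMap.fm]

lemma RB_right {α E : ℝ} (hα : 1 < α) (hE : 0 < E) (f : LorenzMap α) (h : DistProp E f.ψ) :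
    RB α E f.ψ f.v f.c := by
  refine ⟨hα, hE, h, f.hv.1, f.hv.2, f.hc.1, f.hc.2, ?_⟩
  have := f.hright f.c ⟨le_rfl, f.hc.2⟩
  unfold qplus at this
  rw [sub_self, zero_div, abs_zero, Real.zero_rpow (by linarith)] at this
  convert this using 2
  ring

lemma RB_left {α E : ℝ} (hα : 1 < α) (hE : 0 < E) (f : LorenzMap α) (h : DistProp E f.φ) :
    RB α E (fun y => 1 - f.φ (1 - y)) f.u (1 - f.c) := by
  refine ⟨hα, hE, h.reflect, f.hu.1, f.hu.2, by linarith [f.hc.2], by linarith [f.hc.1], ?_⟩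
  have := f.hleft f.c ⟨f.hc.1, le_rfl⟩
  unfold qminus at this
  rw [sub_self, zero_div, abs_zero, Real.zero_rpow (by linarith), sub_zero, mul_one] at this
  have e : 1 - (1 - f.u) = f.u := by ring
  simp only [e]
  linarith

/-- **Size of `C` for bounded critical point.** For every closed interval
`Δ = [d₁,d₂] ⊂ (0,1)` and `δ < (log α)/2` there exist `N`, `K` and `λ > 1` such that
if `f ∈ L_δ` is `(a,b)`-renormalizable, `min{a,b} ≥ N` and `c ∈ Δ`, then
`|C| ≤ K min{c - f₋⁻¹(c), f₊⁻¹(c) - c} λ^(-min{a,b}/α)`. -/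
theorem size_of_C_bounded_critical_point (α : ℝ) (hα : 1 < α) (d₁ d₂ : ℝ)
    (hd₁ : 0 < d₁) (hd : d₁ ≤ d₂) (hd₂ : d₂ < 1) (δ : ℝ) (hδ : δ < Real.log α / 2) :
    ∃ (N : ℕ) (K lam : ℝ), 0 < K ∧ 1 < lam ∧
      ∀ (f : LorenzMap α) (a b : ℕ) (l r : ℝ),
        f.memL δ → ABRenormWith f a b l r → N ≤ min a b → f.c ∈ Set.Icc d₁ d₂ →
        r - l ≤ K * min (f.c - f.fmInv f.c) (f.fpInv f.c - f.c) *
          lam ^ (-(min a b : ℝ) / α) := by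
  by_cases hδ0 : 0 < δ
  swap
  · refine ⟨0, 1, 2, one_pos, one_lt_two, ?_⟩
    intro f a b l r hL
    exact absurd (distProp_of_norm f.hφ hL.1).1 hδ0
  obtain ⟨t1, μ, ht0, ht1, hκ, hμ1, hμ⟩ := consts hα hδ
  set E := Real.exp δ with hEdef
  have hE : 0 < E := Real.exp_pos _
  set d := min d₁ (1 - d₂) with hddef
  have hdpos : 0 < d := lt_min hd₁ (by linarith)
  set B := E / d with hBdef
  have hB : 0 < B := div_pos hE hdpos
  set τ0 := B ^ (-(1 / (α - 1))) with hτ0def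
  have hτ0 : 0 < τ0 := Real.rpow_pos_of_pos hB _
  set lam := min μ (1 + (1 - E * t1 ^ (α - 1)) * τ0) with hlamdef
  have hlam : 1 < lam := lt_min hμ1 (by
    have : 0 < (1 - E * t1 ^ (α - 1)) * τ0 := mul_pos (by linarith) hτ0
    linarith)
  set M := (E ^ 2 * lam / d) ^ (1 / α) with hMdef
  have hM : 0 < M := Real.rpow_pos_of_pos (by positivity) _
  refine ⟨2, 2 * M / (d * τ0), lam, by positivity, hlam, ?_⟩
  intro f a b l r hL hR hN hcΔ
  obtain ⟨⟨⟨g, hl0, hlc, hcr, hr1, -⟩, -⟩, -, -, hA, -, -, -, hB', -, -, -⟩ := hR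
  have ha2 : 2 ≤ a := hN.trans (min_le_left _ _)
  have hb2 : 2 ≤ b := hN.trans (min_le_right _ _)
  have HR := RB_right hα hE f (distProp_of_norm f.hψ hL.2).2
  have HL := RB_left hα hE f (distProp_of_norm f.hφ hL.1).2
  have hFp : ∀ x, f.ψ (qplus α f.v f.c x) = f.fp x := fun x => rfl
  have hFm := fm_reflect f
  have hc := f.hc
  have hdc : d ≤ f.c := (min_le_left _ _).trans hcΔ.1
  have hdc' : d ≤ 1 - f.c := (min_le_right _ _).trans (by linarith [hcΔ.2])
  set c := f.c with hcdef
  set ψ' : ℝ → ℝ := fun y => 1 - f.φ (1 - y) with hψ'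
  have fm_strict : ∀ x y, 0 ≤ x → x < y → y ≤ c → f.fm x < f.fm y := by
    intro x y h1 h2 h3
    have := HL.F_strict (x := 1 - y) (y := 1 - x) (by linarith) (by linarith) (by linarith)
    rw [hFm, hFm] at this
    linarith
  have fp_strict : ∀ x y, c ≤ x → x < y → y ≤ 1 → f.fp x < f.fp y :=
    fun x y h1 h2 h3 => HR.F_strict h1 h2 h3
  have fm_bd : ∀ x, 0 ≤ x → x ≤ c → 0 ≤ f.fm x ∧ f.fm x ≤ 1 := by
    intro x h1 h2
    have m : 1 - x ∈ Icc (1 - c) 1 := ⟨by linarith, by linarith⟩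
    have h3 := HL.F_le_one m
    have h4 := HL.F_nonneg m
    rw [hFm] at h3 h4
    constructor <;> linarith
  have fp_bd : ∀ x, c ≤ x → x ≤ 1 → 0 ≤ f.fp x ∧ f.fp x ≤ 1 :=
    fun x h1 h2 => ⟨HR.F_nonneg ⟨h1, h2⟩, HR.F_le_one ⟨h1, h2⟩⟩
  have fpc : f.fp c < c := f.hright c ⟨le_rfl, hc.2⟩
  have fmc : c < f.fm c := f.hleft c ⟨hc.1, le_rfl⟩
  have exq : ∃ q ∈ Icc c 1, f.fp q = c := HR.exists_q
  have exp' : ∃ p ∈ Icc 0 c, f.fm p = c := by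
    obtain ⟨z, hz, e⟩ := HL.exists_q
    refine ⟨1 - z, ⟨by linarith [hz.2], by linarith [hz.1]⟩, ?_⟩
    have := hFm (1 - z)
    rw [sub_sub_cancel, e] at this
    linarith
  have hqm : f.fpInv c ∈ Icc c 1 := invFunOn_mem exq
  have hqe : f.fp (f.fpInv c) = c := invFunOn_eq exq
  have hpm : f.fmInv c ∈ Icc 0 c := invFunOn_mem exp'
  have hpe : f.fm (f.fmInv c) = c := invFunOn_eq exp'
  generalize f.fpInv c = q at *
  generalize f.fmInv c = p at *
  have hqc : c < q := by
    rcases hqm.1.eq_or_lt with h | h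
    · rw [← h] at hqe; linarith
    · exact h
  have hpc : p < c := by
    rcases hpm.2.eq_or_lt with h | h
    · rw [h] at hpe; linarith
    · exact h
  have tl : ∀ x, x < c → f.toFun x = f.fm x := fun x hx => if_pos hx
  have tr : ∀ x, c < x → f.toFun x = f.fp x := fun x hx => if_neg (not_lt.2 hx.le)
  have lmem : l ∈ Ico l c := ⟨le_rfl, hlc⟩
  have rmem : r ∈ Ioc c r := ⟨hcr, le_rfl⟩
  have hfpp : f.fp c ≤ p := by
    have h1 := hB' 1 le_rfl (by omega) r rmem
    have h2 := hB' 2 (by omega) hb2 r rmem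
    simp only [Function.iterate_succ, Function.iterate_zero, Function.comp_apply, id] at h1 h2
    rw [tr r hcr] at h1 h2
    rw [tl _ h1] at h2
    have h3 := fp_strict c r le_rfl hcr hr1
    by_contra hlt
    push Not at hlt
    have h4 := fm_strict p (f.fp r) hpm.1 (by linarith) h1.le
    linarith
  have hfmq : q ≤ f.fm c := by
    have h1 := hA 1 le_rfl (by omega) l lmem
    have h2 := hA 2 (by omega) ha2 l lmem
    simp only [Function.iterate_succ, Function.iterate_zero, Function.comp_apply, id] at h1 h2
    rw [tl l hlc] at h1 h2
    rw [tr _ h1] at h2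
    have h3 := fm_strict l c hl0 hlc le_rfl
    by_contra hlt
    push Not at hlt
    have h4 := fp_strict (f.fm l) q h1.le (by linarith) hqm.2
    linarith
  have hpm' : 1 - p ∈ Icc (1 - c) 1 := ⟨by linarith [hpm.2], by linarith [hpm.1]⟩
  have u1 := HR.upper hqm
  have u2 := HL.upper hpm'
  rw [hFp, hFp, hqe] at u1
  rw [hFm, hFm, hpe] at u2
  set τ := (q - c) / (1 - c) with hτdef
  set σ := (1 - p - (1 - c)) / (1 - (1 - c)) with hσdef
  have eτ : q - c = (1 - c) * τ := by
    rw [hτdef, mul_div_cancel₀ _ (by linarith [hc.2] : (1 - c) ≠ 0)]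
  have eσ : c - p = c * σ := by
    rw [hσdef]
    have := hc.1.ne'
    have e : 1 - (1 - c) = c := by ring
    rw [e, mul_div_cancel₀ _ this]; ring
  have hτ : 0 < τ := div_pos (by linarith) (by linarith [hc.2])
  have hσ : 0 < σ := div_pos (by linarith) (by linarith [hc.1])
  have b1 : σ ≤ B * τ ^ α := by
    rw [hBdef, div_mul_eq_mul_div, le_div_iff₀ hdpos]
    nlinarith
  have b2 : τ ≤ B * σ ^ α := by
    rw [hBdef, div_mul_eq_mul_div, le_div_iff₀ hdpos]
    nlinarith
  obtain ⟨gτ, gσ⟩ := tau_bound hα hB hτ hσ b1 b2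
  have expR : ∀ x ∈ Icc q 1, lam * (1 - x) ≤ 1 - f.ψ (qplus α f.v c x) := by
    intro x hx
    refine HR.expand (τ := τ0) ht0 ht1 hκ hμ hτ0.le (min_le_left _ _) (min_le_right _ _)
      ⟨hqc.le.trans hx.1, hx.2⟩ (gτ.trans ?_)
    exact div_le_div_of_nonneg_right (by linarith [hx.1]) (by linarith [hc.2])
  have expL : ∀ x ∈ Icc (1 - p) 1, lam * (1 - x) ≤ 1 - ψ' (qplus α f.u (1 - c) x) := by
    intro x hx
    refine HL.expand (τ := τ0) ht0 ht1 hκ hμ hτ0.le (min_le_left _ _) (min_le_right _ _)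
      ⟨by linarith [hx.1], hx.2⟩ (gσ.trans ?_)
    exact div_le_div_of_nonneg_right (by linarith [hx.1]) (by linarith [hc.1])
  have oR := HR.orbit (by linarith) hqm hqe expR (fun i => f.toFun^[i + 1] l) (a - 1)
    (by
      simp only [Function.iterate_succ, Function.iterate_zero, Function.comp_apply, id]
      rw [tl l hlc]; exact (fm_bd l hl0 hlc.le).2)
    (by
      intro i hi
      have := hA (i + 1) (by omega) (by omega) l lmem
      rw [Function.iterate_succ_apply' f.toFun (i + 1), tr _ this]
      rfl)
    (by
      intro i hi
      exact hA (i + 1) (by omega) (by omega) l lmem)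
  have oL := HL.orbit (by linarith) hpm' (by rw [hFm, hpe]) expL
    (fun i => 1 - f.toFun^[i + 1] r) (b - 1)
    (by
      simp only [Function.iterate_succ, Function.iterate_zero, Function.comp_apply, id]
      rw [tr r hcr]; linarith [(fp_bd r hcr.le hr1).1])
    (by
      intro i hi
      have := hB' (i + 1) (by omega) (by omega) r rmem
      rw [Function.iterate_succ_apply' f.toFun (i + 1), tl _ this, hFm])
    (by
      intro i hi
      have := hB' (i + 1) (by omega) (by omega) r rmem
      linarith)
  simp only [Function.iterate_succ, Function.iterate_zero, Function.comp_apply, id] at oR oL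
  rw [tl l hlc] at oR
  rw [tr r hcr, sub_sub_cancel] at oL
  have sR := HR.size hdpos hdc' hlam (b - 1) (min a b) (by omega) ⟨hcr.le, hr1⟩ oL
  have sL := HL.size (x := 1 - l) hdpos (by linarith) hlam (a - 1) (min a b) (by omega)
    ⟨by linarith, by linarith⟩ (by rw [hFm]; exact oR)
  rw [Nat.cast_min] at sR sL
  have hmin : d * τ0 ≤ min (c - p) (q - c) := by
    apply le_min
    · rw [eσ]; exact mul_le_mul hdc gσ hτ0.le hc.1.le
    · rw [eτ]; exact mul_le_mul hdc' gτ hτ0.le (by linarith [hc.2])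
  have hX : 0 < lam ^ (-(min a b : ℝ) / α) := Real.rpow_pos_of_pos (by linarith) _
  calc r - l ≤ 2 * M * lam ^ (-(min a b : ℝ) / α) := by linarith
    _ = 2 * M / (d * τ0) * (d * τ0) * lam ^ (-(min a b : ℝ) / α) := by
        rw [div_mul_cancel₀ _ (by positivity)]
    _ ≤ _ := by gcongr
end
end

section
/- (Koebe space) For every δ < (log α)/2 and every τ > 0 there exists N < ∞ such that: if f ∈ L_δ is an (a,b)-renormalizable Lorenz map with min{a,b} ≥ N, then the interval [f_-^{−1}(c), f_+^{−1}(c)] contains a τ-scaled neighborhood of the return interval C, i.e. it contains an interval T ⊇ C such that both components of T ∖ C have length at least τ·|C|. -/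
open Set Filter Topology MeasureTheory Function

noncomputable section

namespace KS

/-- Left-type branch on `[0,c]`. -/
structure Br (α K c : ℝ) (f : ℝ → ℝ) : Prop where
  D : ∀ x y x' y' : ℝ, 0 ≤ x → x ≤ y → y ≤ c → 0 ≤ x' → x' ≤ y' → y' ≤ c →
    (f y - f x) * (((c - x') / c) ^ α - ((c - y') / c) ^ α) ≤
      K * (f y' - f x') * (((c - x) / c) ^ α - ((c - y) / c) ^ α)
  mono : StrictMonoOn f (Icc 0 c)
  f0 : f 0 = 0
  ge : ∀ x ∈ Icc 0 c, x ≤ f x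
  lt : c < f c
  le1 : f c ≤ 1

/-- Half of the renormalization data. -/
structure Half (α K c d : ℝ) (f g : ℝ → ℝ) (a : ℕ) (l ρ p : ℝ) (x y : ℕ → ℝ) : Prop where
  br : Br α K c f
  l0 : 0 ≤ l
  lc : l < c
  p0 : 0 ≤ p
  pc : p ≤ c
  fp : f p = c
  xa : x a = 1 - f c
  ya : y a = 1 - f l
  y0 : y 0 = 1 - l
  x0l : ρ ≤ x 0
  x0u : x 0 ≤ d
  gx : ∀ i < a, g (x (i+1)) = x i
  gy : ∀ i < a, g (y (i+1)) = y i
  xn : ∀ i < a, 0 ≤ x (i+1)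
  xy : ∀ i ≤ a, x i ≤ y i
  yd : ∀ i < a, y (i+1) < d

section
variable {α K c d : ℝ} {f g : ℝ → ℝ}

lemma contr0 (hα : 1 < α) (hc : 0 < c) (h : Br α K c f) {x y : ℝ}
    (hx : 0 ≤ x) (hxy : x ≤ y) (hy : y < c) (hfy : f y < f c) :
    ((c - x) / (c - y)) ^ α ≤ 1 + K * (f y - f x) / (f c - f y) := by
  have h1 := h.D y c x y (hx.trans hxy) hy.le le_rfl hx hxy hy.le
  have h0 : ((c - c) / c) ^ α = 0 := by
    rw [sub_self, zero_div, Real.zero_rpow (by linarith)]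
  rw [h0] at h1
  have hzy : 0 < ((c - y) / c) ^ α := Real.rpow_pos_of_pos (div_pos (by linarith) hc) _
  have e : ((c - x) / (c - y)) ^ α = ((c - x) / c) ^ α / ((c - y) / c) ^ α := by
    rw [← Real.div_rpow (div_nonneg (by linarith) hc.le) (div_nonneg (by linarith) hc.le)]
    congr 1
    have : c - y ≠ 0 := by linarith
    field_simp
  rw [e, div_le_iff₀ hzy]
  have hp : 0 < f c - f y := by linarith
  have : K * (f y - f x) / (f c - f y) * ((c - y) / c) ^ α =
      K * (f y - f x) * (((c - y) / c) ^ α - 0) / (f c - f y) := by ring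
  rw [add_mul, this, ← sub_le_iff_le_add', le_div_iff₀ hp]
  linarith

/-- `log` version of the contraction. -/
lemma contr_log (hα : 1 < α) (hK : 1 ≤ K) (hc : 0 < c) (h : Br α K c f) {x y : ℝ}
    (hx : 0 ≤ x) (hxy : x ≤ y) (hy : y < c) (hfx : 0 ≤ f x) (hfy : f y < c) :
    Real.log ((c - x) / (c - y)) ≤ (K / α) * Real.log ((c - f x) / (c - f y)) ∧
    Real.log ((c - x) / (c - y)) ≤
      (K / α * (c / (f c - c))) * Real.log ((c - f x) / (c - f y)) := by
  have hlt := h.lt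
  have hm : f x ≤ f y := h.mono.monotoneOn ⟨hx, by linarith⟩ ⟨by linarith, hy.le⟩ hxy
  have h1 := contr0 hα hc h hx hxy hy (by linarith)
  have hZ : 0 < (c - x) / (c - y) := div_pos (by linarith) (by linarith)
  have hα0 : 0 < α := by linarith
  have hW1 : 1 ≤ (c - f x) / (c - f y) := by rw [le_div_iff₀ (by linarith)]; linarith
  set W := (c - f x) / (c - f y) with hW
  have hWe : (f y - f x) / (c - f y) = W - 1 := by
    rw [hW]; have : c - f y ≠ 0 := by linarith
    field_simp; ring
  have key : Real.log ((c - x) / (c - y)) ≤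
      1 / α * Real.log (1 + K * (f y - f x) / (f c - f y)) := by
    have := Real.log_le_log (Real.rpow_pos_of_pos hZ α) h1
    rw [Real.log_rpow hZ] at this
    rw [div_mul_eq_mul_div, one_mul, le_div_iff₀ hα0]; linarith
  have hnn : 0 ≤ K * (f y - f x) / (f c - f y) :=
    div_nonneg (mul_nonneg (by linarith) (by linarith)) (by linarith)
  constructor
  · refine key.trans ?_
    have h2 : 1 + K * (f y - f x) / (f c - f y) ≤ W ^ K := by
      have hb := one_add_mul_self_le_rpow_one_add (s := W - 1) (p := K) (by linarith) hK
      have : K * (f y - f x) / (f c - f y) ≤ K * (W - 1) := by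
        rw [← hWe, mul_div_assoc]
        apply mul_le_mul_of_nonneg_left _ (by linarith)
        apply div_le_div_of_nonneg_left <;> linarith
      have e : 1 + (W - 1) = W := by ring
      rw [e] at hb
      linarith
    have h3 := Real.log_le_log (by linarith) h2
    rw [Real.log_rpow (by linarith)] at h3
    calc 1 / α * Real.log (1 + K * (f y - f x) / (f c - f y)) ≤ 1 / α * (K * Real.log W) :=
          mul_le_mul_of_nonneg_left h3 (by positivity)
      _ = _ := by ring
  · refine key.trans ?_
    have h2 : Real.log (1 + K * (f y - f x) / (f c - f y)) ≤ K * (f y - f x) / (f c - f y) := by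
      have := Real.log_le_sub_one_of_pos (show 0 < 1 + K * (f y - f x) / (f c - f y) by linarith)
      linarith
    have h3 : f y - f x ≤ c * Real.log W := by
      have h4 := Real.one_sub_inv_le_log_of_pos (show 0 < W by linarith)
      have h5 : f y - f x = (c - f x) * (1 - W⁻¹) := by
        rw [hW, inv_div]
        have : c - f x ≠ 0 := by linarith
        field_simp; ring
      have h6 : 0 ≤ Real.log W := Real.log_nonneg hW1
      rw [h5]
      calc _ ≤ (c - f x) * Real.log W := mul_le_mul_of_nonneg_left h4 (by linarith)
        _ ≤ _ := mul_le_mul_of_nonneg_right (by linarith) h6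
    have h6 : 0 ≤ c * Real.log W := by linarith
    have h7 : K * (f y - f x) / (f c - f y) ≤ K * (c * Real.log W) / (f c - c) := by
      apply div_le_div₀ (by positivity) _ (by linarith) (by linarith)
      exact mul_le_mul_of_nonneg_left h3 (by linarith)
    calc 1 / α * Real.log (1 + K * (f y - f x) / (f c - f y))
        ≤ 1 / α * (K * (c * Real.log W) / (f c - c)) :=
          mul_le_mul_of_nonneg_left (h2.trans h7) (by positivity)
      _ = _ := by ring

variable {a b : ℕ} {l ρ p q : ℝ} {x y x' y' : ℕ → ℝ}

lemma chain (hα : 1 < α) (hK : 1 ≤ K) (hd : 0 < d) (H : Half α K c d f g a l ρ p x y)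
    (hg : Br α K d g) (μ : ℝ) (hμ0 : 0 ≤ μ)
    (hμ : K / α ≤ μ ∨ K / α * (d / (g d - d)) ≤ μ) (i m : ℕ) (him : i + 1 + m ≤ a) :
    Real.log ((d - x (i + 1 + m)) / (d - y (i + 1 + m))) ≤
      μ ^ m * Real.log ((d - x (i+1)) / (d - y (i+1))) := by
  induction m with
  | zero => simp
  | succ m ih =>
    have ih := ih (by omega)
    have e1 : g (x (i + 1 + (m+1))) = x (i + 1 + m) := H.gx (i+1+m) (by omega)
    have e2 : g (y (i + 1 + (m+1))) = y (i + 1 + m) := H.gy (i+1+m) (by omega)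
    have n1 : 0 ≤ x (i+1+(m+1)) := H.xn (i+1+m) (by omega)
    have n2 : 0 ≤ x (i+1+m) := by
      have := H.xn (i+m) (by omega); rwa [show i + m + 1 = i + 1 + m by ring] at this
    have n3 : y (i+1+m) < d := by
      have := H.yd (i+m) (by omega); rwa [show i + m + 1 = i + 1 + m by ring] at this
    have h3 := H.xy (i+1+m) (by omega)
    have hc := contr_log hα hK hd hg n1 (H.xy (i+1+(m+1)) (by omega)) (H.yd (i+1+m) (by omega))
      (by rw [e1]; exact n2) (by rw [e2]; exact n3)
    rw [e1, e2] at hc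
    have hlog : 0 ≤ Real.log ((d - x (i + 1 + m)) / (d - y (i + 1 + m))) := by
      apply Real.log_nonneg
      rw [le_div_iff₀ (by linarith)]; linarith
    have h4 : Real.log ((d - x (i + 1 + (m+1))) / (d - y (i + 1 + (m+1)))) ≤
        μ * Real.log ((d - x (i + 1 + m)) / (d - y (i + 1 + m))) := by
      rcases hμ with h | h
      · exact hc.1.trans (mul_le_mul_of_nonneg_right h hlog)
      · exact hc.2.trans (mul_le_mul_of_nonneg_right h hlog)
    calc _ ≤ _ := h4
      _ ≤ μ * (μ ^ m * Real.log ((d - x (i+1)) / (d - y (i+1)))) :=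
        mul_le_mul_of_nonneg_left ih hμ0
      _ = _ := by ring


lemma rpow_sub_le (hα : 1 < α) {z w : ℝ} (hw : 0 ≤ w) (hwz : w ≤ z) (hz : z ≤ 1) :
    z ^ α - w ^ α ≤ α * (z - w) := by
  rcases eq_or_lt_of_le (hw.trans hwz) with h0 | h0
  · have : w = z := by linarith
    subst this; simp
  have hb := one_add_mul_self_le_rpow_one_add (s := w / z - 1) (p := α)
    (by have := div_nonneg hw h0.le; linarith) hα.le
  have e : 1 + (w / z - 1) = w / z := by ring
  rw [e, Real.div_rpow hw h0.le, le_div_iff₀ (Real.rpow_pos_of_pos h0 _)] at hb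
  have h1 : z ^ α ≤ z := by
    have := Real.rpow_le_rpow_of_exponent_ge h0 hz hα.le
    simpa using this
  have h2 : z ^ α * (1 - w / z) ≤ z * (1 - w / z) := by
    apply mul_le_mul_of_nonneg_right h1
    rw [sub_nonneg, div_le_one h0]; exact hwz
  have h3 : z * (1 - w / z) = z - w := by field_simp
  have h4 : z ^ α - w ^ α ≤ α * (z ^ α * (1 - w / z)) := by linarith
  rw [h3] at h2
  exact h4.trans (mul_le_mul_of_nonneg_left h2 (by linarith))

/-- Both halves of the data. -/
structure Pair (α K c d : ℝ) (f g : ℝ → ℝ) (a b : ℕ) (l ρ p q : ℝ) (x y x' y' : ℕ → ℝ) :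
    Prop where
  hα : 1 < α
  hK : 1 ≤ K
  hKα : K < α
  hc : 0 < c
  hd : 0 < d
  hcd : c + d = 1
  H : Half α K c d f g a l ρ p x y
  H' : Half α K d c g f b ρ l q x' y'
  ha : 2 ≤ a
  hb : 2 ≤ b

lemma Pair.symm (h : Pair α K c d f g a b l ρ p q x y x' y') :
    Pair α K d c g f b a ρ l q p x' y' x y :=
  ⟨h.hα, h.hK, h.hKα, h.hd, h.hc, by linarith [h.hcd], h.H', h.H, h.hb, h.ha⟩

lemma zc (hα : 1 < α) : ((c - c) / c) ^ α = 0 := by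
  rw [sub_self, zero_div, Real.zero_rpow (by linarith)]

lemma z0 (hc : 0 < c) : ((c - 0) / c) ^ α = 1 := by
  rw [sub_zero, div_self hc.ne', Real.one_rpow]

section

lemma Pair.ya_lt (h : Pair α K c d f g a b l ρ p q x y x' y')
    : y a < d := by
  have := h.H.yd (a-1) (by have := h.ha; omega)
  rwa [show a - 1 + 1 = a by have := h.ha; omega] at this

lemma Pair.fl (h : Pair α K c d f g a b l ρ p q x y x' y')
    : c < f l := by
  have := h.ya_lt; rw [h.H.ya] at this; linarith [h.hcd]

lemma Pair.p_lt_l (h : Pair α K c d f g a b l ρ p q x y x' y')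
    : p < l := by
  by_contra hh
  push Not at hh
  have := h.H.br.mono.monotoneOn ⟨h.H.l0, h.H.lc.le⟩ ⟨h.H.p0, h.H.pc⟩ hh
  rw [h.H.fp] at this
  linarith [h.fl]

lemma Pair.A_rpow (h : Pair α K c d f g a b l ρ p q x y x' y')
    : ((c - l) / c) ^ α ≤ K * Real.log ((d - x a) / (d - y a)) := by
  have hα := h.hα
  have h1 := h.H.br.D 0 c l c le_rfl h.hc.le le_rfl h.H.l0 h.H.lc.le le_rfl
  rw [zc hα, z0 h.hc, h.H.br.f0] at h1
  have hlt := h.H.br.lt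
  have hc := h.hc
  have hcd := h.hcd
  have hfl := h.fl
  have hm : f l < f c := h.H.br.mono ⟨h.H.l0, h.H.lc.le⟩ ⟨hc.le, le_rfl⟩ h.H.lc
  have e1 : d - x a = f c - c := by rw [h.H.xa]; linarith
  have e2 : d - y a = f l - c := by rw [h.H.ya]; linarith
  rw [e1, e2]
  have h2 := Real.one_sub_inv_le_log_of_pos
    (show 0 < (f c - c) / (f l - c) from div_pos (by linarith) (by linarith))
  rw [inv_div] at h2
  set L := Real.log ((f c - c) / (f l - c))
  have h3 : f c - f l ≤ (f c - c) * L := by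
    have h4 : f c - f l = (f c - c) * (1 - (f l - c) / (f c - c)) := by
      have : f c - c ≠ 0 := by linarith
      field_simp; ring
    rw [h4]; exact mul_le_mul_of_nonneg_left h2 (by linarith)
  have hL : 0 ≤ L := by
    apply Real.log_nonneg
    rw [le_div_iff₀ (by linarith)]; linarith
  have h5 : f c - f l ≤ f c * L := h3.trans (mul_le_mul_of_nonneg_right (by linarith) hL)
  have h6 : f c * ((c - l) / c) ^ α ≤ f c * (K * L) := by
    have := mul_le_mul_of_nonneg_left h5 (show 0 ≤ K by linarith [h.hK])
    nlinarith
  exact le_of_mul_le_mul_left h6 (by linarith)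

lemma Pair.P_low (h : Pair α K c d f g a b l ρ p q x y x' y')
    : f c - c ≤ K * f c * ((c - p) / c) ^ α := by
  have h1 := h.H.br.D p c 0 c h.H.p0 h.H.pc le_rfl le_rfl h.hc.le le_rfl
  rw [zc h.hα, z0 h.hc, h.H.br.f0, h.H.fp] at h1
  linarith

lemma Pair.P_up (h : Pair α K c d f g a b l ρ p q x y x' y')
    : f c * ((c - p) / c) ^ α ≤ K * (f c - c) := by
  have h1 := h.H.br.D 0 c p c le_rfl h.hc.le le_rfl h.H.p0 h.H.pc le_rfl
  rw [zc h.hα, z0 h.hc, h.H.br.f0, h.H.fp] at h1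
  linarith

lemma Pair.PA_rpow (h : Pair α K c d f g a b l ρ p q x y x' y')
    : ((c - p) / c) ^ α ≤
    K ^ 2 * ((d - x a) / (d - y a)) * (((c - p) / c) ^ α - ((c - l) / c) ^ α) := by
  have hlt := h.H.br.lt
  have hc := h.hc
  have hcd := h.hcd
  have hfl := h.fl
  have hK := h.hK
  have h1 := h.H.br.D p l 0 c h.H.p0 h.p_lt_l.le h.H.lc.le le_rfl hc.le le_rfl
  rw [zc h.hα, z0 h.hc, h.H.br.f0, h.H.fp] at h1
  have h2 := h.P_up
  have e1 : d - x a = f c - c := by rw [h.H.xa]; linarith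
  have e2 : d - y a = f l - c := by rw [h.H.ya]; linarith
  rw [e1, e2]
  set Pα := ((c - p) / c) ^ α
  set Aα := ((c - l) / c) ^ α
  have h3 : f c - c ≤ (f c - c) / (f l - c) * (K * f c * (Pα - Aα)) := by
    have hq : 0 ≤ (f c - c) / (f l - c) := div_nonneg (by linarith) (by linarith)
    calc f c - c = (f c - c) / (f l - c) * (f l - c) := by
          have : f l - c ≠ 0 := by linarith
          field_simp
      _ ≤ _ := mul_le_mul_of_nonneg_left (by linarith) hq
  have h4 : f c * Pα ≤ f c * (K ^ 2 * ((f c - c) / (f l - c)) * (Pα - Aα)) := by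
    calc _ ≤ _ := h2
      _ ≤ K * ((f c - c) / (f l - c) * (K * f c * (Pα - Aα))) :=
        mul_le_mul_of_nonneg_left h3 (by linarith)
      _ = _ := by ring
  exact le_of_mul_le_mul_left h4 (by linarith)

lemma Pair.x_anti (h : Pair α K c d f g a b l ρ p q x y x' y')
    (i : ℕ) (hi : i < a) : x (i+1) ≤ x i := by
  have h1 := h.H.gx i hi
  have h2 := h.H'.br.ge (x (i+1)) ⟨h.H.xn i hi, (h.H.xy (i+1) hi).trans (h.H.yd i hi).le⟩
  linarith

lemma Pair.x_anti' (h : Pair α K c d f g a b l ρ p q x y x' y')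
    (i m : ℕ) (hi : i + m ≤ a) : x (i+m) ≤ x i := by
  induction m with
  | zero => simp
  | succ m ih => exact (h.x_anti (i+m) (by omega)).trans (ih (by omega))

lemma Pair.x1_le (h : Pair α K c d f g a b l ρ p q x y x' y')
    : x 1 ≤ q := by
  have ha := h.ha
  by_contra hh
  push Not at hh
  have h1 := h.H'.br.mono ⟨h.H'.p0, h.H'.pc⟩
    ⟨h.H.xn 0 (by omega), (h.H.xy 1 (by omega)).trans (h.H.yd 0 (by omega)).le⟩ hh
  rw [h.H'.fp] at h1
  have h2 := h.H.gx 0 (by omega)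
  simp only [zero_add] at h2
  linarith [h.H.x0u]

lemma Pair.fc_ge (h : Pair α K c d f g a b l ρ p q x y x' y')
    : d - q ≤ f c - c := by
  have ha := h.ha
  have h1 := h.x1_le
  have h2 := h.x_anti' 1 (a-1) (by omega)
  rw [show 1 + (a-1) = a by omega, h.H.xa] at h2
  linarith [h.hcd]

lemma Pair.Q_low (h : Pair α K c d f g a b l ρ p q x y x' y')
    : c * ((c - p) / c) ≤ K * ((d - q) / d) ^ α := by
  have h1 := h.symm.P_low
  have h2 := h.symm.fc_ge
  have h3 := h.H'.br.le1
  have hK := h.hK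
  have e : c * ((c - p) / c) = c - p := by have := h.hc.ne'; field_simp
  rw [e]
  have h4 : 0 ≤ ((d - q) / d) ^ α :=
    Real.rpow_nonneg (div_nonneg (by linarith [h.H'.pc]) h.hd.le) _
  nlinarith [mul_nonneg (show 0 ≤ K by linarith) h4]

lemma Pair.P_pos (h : Pair α K c d f g a b l ρ p q x y x' y')
    : p < c := h.p_lt_l.trans h.H.lc

lemma Pair.gap (h : Pair α K c d f g a b l ρ p q x y x' y')
    (hcd : c ≤ d) : (d - q) / d ≤ 4 * K * α * (f c - 1 + ρ) := by
  have ha := h.ha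
  have hb := h.hb
  have hd := h.hd
  have hcd' := h.hcd
  have hK := h.hK
  have hα := h.hα
  have h2 := h.x_anti' 2 (a-2) (by omega)
  rw [show 2 + (a-2) = a by omega, h.H.xa] at h2
  have n2 : 0 ≤ x 2 := h.H.xn 1 (by omega)
  have g2 : g (x 2) = x 1 := h.H.gx 1 (by omega)
  have hx1 := h.x1_le
  have hgρ := h.symm.fl
  have hqd := h.H'.pc
  have hxρ : x 2 ≤ ρ := by
    by_contra hh
    push Not at hh
    have := h.H'.br.mono ⟨h.H'.l0, h.H'.lc.le⟩
      ⟨n2, (h.H.xy 2 (by omega)).trans (h.H.yd 1 (by omega)).le⟩ hh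
    linarith
  have h1 := h.H'.br.D (x 2) ρ 0 d n2 hxρ h.H'.lc.le le_rfl hd.le le_rfl
  rw [zc hα, z0 hd, h.H'.br.f0, g2] at h1
  have h3 := rpow_sub_le hα (z := (d - x 2) / d) (w := (d - ρ) / d)
    (div_nonneg (by linarith [h.H'.lc]) hd.le) (by gcongr)
    (by rw [div_le_one hd]; linarith)
  have h4 : (d - x 2) / d - (d - ρ) / d = (ρ - x 2) / d := by ring
  rw [h4] at h3
  have hz : 0 ≤ ((d - x 2) / d) ^ α - ((d - ρ) / d) ^ α := by
    rw [sub_nonneg]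
    apply Real.rpow_le_rpow (div_nonneg (by linarith [h.H'.lc]) hd.le) (by gcongr) (by linarith)
  have hle := h.H'.br.le1
  have h5 : d - q ≤ K * (α * ((ρ - x 2) / d)) := by
    have : K * (g d - 0) * (((d - x 2) / d) ^ α - ((d - ρ) / d) ^ α) ≤
        K * (((d - x 2) / d) ^ α - ((d - ρ) / d) ^ α) := by
      apply mul_le_mul_of_nonneg_right _ hz
      nlinarith
    have h6 := mul_le_mul_of_nonneg_left h3 (show 0 ≤ K by linarith)
    linarith
  have hd2 : 1 / d ≤ 2 := by rw [div_le_iff₀ hd]; linarith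
  have hdp : 0 < 1 / d := by positivity
  have h7 : (d - q) / d ≤ 2 * (d - q) := by
    rw [div_eq_mul_one_div]; nlinarith
  have h8 : (ρ - x 2) / d ≤ 2 * (ρ - x 2) := by
    rw [div_eq_mul_one_div]; nlinarith
  have h9 : K * (α * ((ρ - x 2) / d)) ≤ K * (α * (2 * (f c - 1 + ρ))) := by
    apply mul_le_mul_of_nonneg_left _ (by linarith)
    apply mul_le_mul_of_nonneg_left _ (by linarith)
    linarith
  linarith

end


lemma numP (hα : 1 < α) (hK : 1 ≤ K) : ∃ p0 : ℝ, 0 < p0 ∧ ∀ c d P Q T : ℝ, 0 < c → c ≤ d →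
    c + d = 1 → 0 < P → P ≤ 1 → 0 ≤ Q → c * P ≤ K * Q ^ α → T - c ≤ K * T * P ^ α →
    c + d * Q ≤ T → p0 ≤ P := by
  have hM : 0 < K * (4 * K) ^ α := by positivity
  have hα2 : 0 < α ^ 2 - 1 := by nlinarith
  refine ⟨min (1 / (2 * K)) ((1 / (K * (4 * K) ^ α)) ^ (1 / (α ^ 2 - 1))),
    lt_min (by positivity) (by positivity), ?_⟩
  intro c d P Q T hc hcd hcd1 hP hP1 hQ h1 h2 h3
  have hPα : P ^ α ≤ P := by
    have := Real.rpow_le_rpow_of_exponent_ge hP hP1 hα.le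
    simpa using this
  have hPα0 : 0 < P ^ α := Real.rpow_pos_of_pos hP _
  have hd : 0 < d := by linarith
  have hdQ : 0 ≤ d * Q := by positivity
  have hT : 0 < T := by linarith
  rcases le_or_gt c (d * Q) with hh | hh
  · refine (min_le_left _ _).trans ?_
    rw [div_le_iff₀ (by positivity)]
    have h4 : T / 2 ≤ K * T * P ^ α := by linarith
    have h5 : 1 / 2 ≤ K * P ^ α := by
      by_contra hcon
      push Not at hcon
      nlinarith
    have h6 : K * P ^ α ≤ K * P := mul_le_mul_of_nonneg_left hPα (by linarith)
    linarith
  · refine (min_le_right _ _).trans ?_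
    have h4 : d * Q ≤ K * (c + d * Q) * P ^ α := by
      by_cases hKP : K * P ^ α ≤ 1
      · nlinarith
      · push Not at hKP
        nlinarith
    have h5 : Q ≤ 4 * K * c * P ^ α := by
      have : K * (c + d * Q) * P ^ α ≤ K * (2 * c) * P ^ α := by
        apply mul_le_mul_of_nonneg_right _ hPα0.le
        apply mul_le_mul_of_nonneg_left _ (by linarith)
        linarith
      nlinarith
    have h6 : Q ^ α ≤ (4 * K) ^ α * c ^ α * P ^ (α ^ 2) := by
      have := Real.rpow_le_rpow hQ h5 (show 0 ≤ α by linarith)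
      rwa [Real.mul_rpow (by positivity) hPα0.le, Real.mul_rpow (by positivity) hc.le,
        ← Real.rpow_mul hP.le, ← sq] at this
    have hcα : c ^ α ≤ c := by
      have := Real.rpow_le_rpow_of_exponent_ge hc (by linarith) hα.le
      simpa using this
    have h7 : c * P ≤ c * (K * (4 * K) ^ α * P ^ (α ^ 2)) := by
      calc c * P ≤ K * ((4 * K) ^ α * c ^ α * P ^ (α ^ 2)) :=
            h1.trans (mul_le_mul_of_nonneg_left h6 (by linarith))
        _ ≤ K * ((4 * K) ^ α * c * P ^ (α ^ 2)) := by gcongr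
        _ = _ := by ring
    have h8 := le_of_mul_le_mul_left h7 hc
    have e : P ^ (α ^ 2) = P ^ (α ^ 2 - 1) * P := by
      rw [← Real.rpow_add_one hP.ne']; congr 1; ring
    rw [e, ← mul_assoc] at h8
    have h9 : 1 ≤ K * (4 * K) ^ α * P ^ (α ^ 2 - 1) := by
      by_contra hcon
      push Not at hcon
      nlinarith
    have h10 : 1 / (K * (4 * K) ^ α) ≤ P ^ (α ^ 2 - 1) := by
      rw [div_le_iff₀ hM]; linarith
    have h11 := Real.rpow_le_rpow (by positivity) h10 (show 0 ≤ 1 / (α ^ 2 - 1) by positivity)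
    rwa [← Real.rpow_mul hP.le, mul_one_div_cancel hα2.ne', Real.rpow_one] at h11

lemma pair_P (hα : 1 < α) (hK : 1 ≤ K) : ∃ p0 : ℝ, 0 < p0 ∧
    ∀ (c d : ℝ) (f g : ℝ → ℝ) (a b : ℕ) (l ρ p q : ℝ) (x y x' y' : ℕ → ℝ),
      Pair α K c d f g a b l ρ p q x y x' y' → c ≤ d → p0 ≤ (c - p) / c := by
  obtain ⟨p0, hp0, h0⟩ := numP hα hK
  refine ⟨p0, hp0, ?_⟩
  intro c d f g a b l ρ p q x y x' y' h hcd
  have hd := h.hd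
  refine h0 c d ((c - p) / c) ((d - q) / d) (f c) h.hc hcd h.hcd
    (div_pos (by linarith [h.P_pos]) h.hc) ?_ (div_nonneg (by linarith [h.H'.pc]) h.hd.le)
    h.Q_low h.P_low ?_
  · rw [div_le_one h.hc]; linarith [h.H.p0]
  · have e : d * ((d - q) / d) = d - q := by field_simp
    rw [e]; linarith [h.fc_ge]

lemma pair_Q (hα : 1 < α) (hK : 1 ≤ K) : ∃ k : ℝ, 0 < k ∧
    ∀ (c d : ℝ) (f g : ℝ → ℝ) (a b : ℕ) (l ρ p q : ℝ) (x y x' y' : ℕ → ℝ),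
      Pair α K c d f g a b l ρ p q x y x' y' → c ≤ d → k * c ^ (1 / α) ≤ (d - q) / d := by
  obtain ⟨p0, hp0, h0⟩ := pair_P hα hK
  refine ⟨(p0 / K) ^ (1 / α), by positivity, ?_⟩
  intro c d f g a b l ρ p q x y x' y' h hcd
  have h1 := h0 _ _ _ _ _ _ _ _ _ _ _ _ _ _ h hcd
  have h2 := h.Q_low
  have hc := h.hc
  have hQ : 0 ≤ (d - q) / d := div_nonneg (by linarith [h.H'.pc]) h.hd.le
  have hK0 : 0 < K := by linarith
  have hα0 : α ≠ 0 := by linarith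
  have h3 : p0 / K * c ≤ ((d - q) / d) ^ α := by
    have : c * p0 ≤ K * ((d - q) / d) ^ α := (mul_le_mul_of_nonneg_left h1 hc.le).trans h2
    rw [div_mul_eq_mul_div, div_le_iff₀ hK0]; linarith
  have h4 := Real.rpow_le_rpow (by positivity) h3 (show 0 ≤ 1 / α by positivity)
  rwa [Real.mul_rpow (by positivity) hc.le, ← Real.rpow_mul hQ, mul_one_div_cancel hα0,
    Real.rpow_one] at h4

section

lemma Pair.Z1_rpow (h : Pair α K c d f g a b l ρ p q x y x' y')
    : 1 ≤ (d - x 1) / (d - y 1) ∧ 0 < g d - y 0 ∧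
    ((d - x 1) / (d - y 1)) ^ α ≤ 1 + K * (y 0 - x 0) / (g d - y 0) := by
  have ha := h.ha
  have n1 : 0 ≤ x 1 := h.H.xn 0 (by omega)
  have n2 : y 1 < d := h.H.yd 0 (by omega)
  have n3 := h.H.xy 1 (by omega)
  have g1 : g (x 1) = x 0 := h.H.gx 0 (by omega)
  have g2 : g (y 1) = y 0 := h.H.gy 0 (by omega)
  have hlt : g (y 1) < g d := h.H'.br.mono ⟨n1.trans n3, n2.le⟩ ⟨h.hd.le, le_rfl⟩ n2
  have := contr0 h.hα h.hd h.H'.br n1 n3 n2 hlt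
  rw [g1, g2] at this
  refine ⟨?_, by linarith, this⟩
  rw [le_div_iff₀ (by linarith)]; linarith

end

lemma le_rpow_self (hα : 1 < α) {z : ℝ} (hz : 1 ≤ z) : z ≤ z ^ α := by
  have := Real.rpow_le_rpow_of_exponent_le hz hα.le
  simpa using this

lemma exists_pow (hν : 0 ≤ d) (hν1 : d < 1) (M ε : ℝ) (hε : 0 < ε) :
    ∃ N : ℕ, ∀ n, N ≤ n → M * d ^ n ≤ ε := by
  have h := (tendsto_pow_atTop_nhds_zero_of_lt_one hν hν1).const_mul M
  rw [mul_zero] at h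
  have := (h.eventually (gt_mem_nhds hε))
  obtain ⟨N, hN⟩ := eventually_atTop.1 this
  exact ⟨N, fun n hn => (hN n hn).le⟩

lemma pair_B (hα : 1 < α) (hK : 1 ≤ K) (hKα : K < α) (ε : ℝ) (hε : 0 < ε) : ∃ N : ℕ,
    ∀ (c d : ℝ) (f g : ℝ → ℝ) (a b : ℕ) (l ρ p q : ℝ) (x y x' y' : ℕ → ℝ),
      Pair α K c d f g a b l ρ p q x y x' y' → c ≤ d → N ≤ b → (d - ρ) / d ≤ ε * c := by
  obtain ⟨k, hk, hQ⟩ := pair_Q hα hK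
  have hα0 : 0 < α := by linarith
  have hK0 : 0 < K := by linarith
  have hν0 : 0 ≤ K / α := by positivity
  have hν1 : K / α < 1 := by rw [div_lt_one hα0]; exact hKα
  have hβ : 0 < 1 - 1 / α := by
    rw [sub_pos, div_lt_one hα0]; exact hα
  obtain ⟨n0, hn0⟩ := exists_nat_ge ((α + 1) / (1 - 1 / α))
  rw [div_le_iff₀ hβ] at hn0
  set M := 1 + 4 * K ^ 2 * α / k with hM
  have hMpos : 0 < M := by positivity
  obtain ⟨N, hN⟩ := exists_pow hν0 hν1 (K * M * (2 / k) ^ n0) (ε ^ α) (by positivity)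
  refine ⟨N + 1 + n0, ?_⟩
  intro c d f g a b l ρ p q x y x' y' h hcd hb
  have hQ := hQ _ _ _ _ _ _ _ _ _ _ _ _ _ _ h hcd
  have hc := h.hc
  have hd := h.hd
  have hcd1 := h.hcd
  have hc1 : c ≤ 1 := by linarith
  have hroot : c ≤ c ^ (1 / α) := by
    have := Real.rpow_le_rpow_of_exponent_ge hc hc1 (show 1 / α ≤ 1 by linarith)
    simpa using this
  have hrootpos : 0 < c ^ (1 / α) := Real.rpow_pos_of_pos hc _
  -- critical value gap
  have hgap1 : k / 2 * c ^ (1 / α) ≤ f c - c := by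
    have h1 := h.fc_ge
    have h2 : d - q = d * ((d - q) / d) := by field_simp
    have h3 : 0 ≤ (d - q) / d := div_nonneg (by linarith [h.H'.pc]) hd.le
    have h4 : 1 / 2 * ((d - q) / d) ≤ d * ((d - q) / d) :=
      mul_le_mul_of_nonneg_right (by linarith) h3
    linarith
  have hgap2 : k * c ≤ 4 * K * α * (f c - 1 + ρ) := by
    have h1 := h.gap hcd
    have h2 : k * c ≤ k * c ^ (1 / α) := mul_le_mul_of_nonneg_left hroot hk.le
    linarith
  -- first step
  obtain ⟨hz1, hpos, hz⟩ := h.symm.Z1_rpow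
  have hy0 := h.H'.y0
  have hx0 := h.H'.x0l
  have hl0 := h.H.l0
  have hρ0 := h.H'.l0
  have hZ1 : Real.log ((c - x' 1) / (c - y' 1)) ≤ M / c := by
    have h1 : Real.log ((c - x' 1) / (c - y' 1)) ≤ (c - x' 1) / (c - y' 1) := by
      have := Real.log_le_sub_one_of_pos (show 0 < (c - x' 1) / (c - y' 1) by linarith)
      linarith
    have h2 := le_rpow_self hα hz1
    have h3 : K * (y' 0 - x' 0) / (f c - y' 0) ≤ 4 * K ^ 2 * α / k / c := by
      rw [div_le_iff₀ hpos]
      have h4 : f c - y' 0 = f c - 1 + ρ := by rw [hy0]; ring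
      rw [h4]
      have h5 : K * (y' 0 - x' 0) ≤ K * 1 := by
        apply mul_le_mul_of_nonneg_left _ hK0.le
        linarith
      have h6 : K * 1 = K / (k * c) * (k * c) := by field_simp
      have h7 : K / (k * c) * (k * c) ≤ K / (k * c) * (4 * K * α * (f c - 1 + ρ)) :=
        mul_le_mul_of_nonneg_left hgap2 (by positivity)
      have h8 : K / (k * c) * (4 * K * α * (f c - 1 + ρ)) =
          4 * K ^ 2 * α / k / c * (f c - 1 + ρ) := by field_simp
      linarith
    have h9 : (1 : ℝ) ≤ 1 / c := by rw [le_div_iff₀ hc]; linarith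
    have h10 : M / c = 1 / c + 4 * K ^ 2 * α / k / c := by rw [hM]; ring
    linarith
  have hZ0 : 0 ≤ Real.log ((c - x' 1) / (c - y' 1)) := Real.log_nonneg hz1
  have hpw : 0 < c ^ (1 - 1 / α) := Real.rpow_pos_of_pos hc _
  have hμ : K / α * (c / (f c - c)) ≤ 2 / k * c ^ (1 - 1 / α) := by
    have h1 : c / (f c - c) ≤ c / (k / 2 * c ^ (1 / α)) :=
      div_le_div_of_nonneg_left hc.le (by positivity) hgap1
    have h2 : c / (k / 2 * c ^ (1 / α)) = 2 / k * c ^ (1 - 1 / α) := by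
      rw [Real.rpow_sub hc, Real.rpow_one]; field_simp
    have h3 : 0 ≤ c / (f c - c) := div_nonneg hc.le (by linarith [h.H.br.lt])
    nlinarith
  have hch1 := chain hα hK hc h.H' h.H.br (2 / k * c ^ (1 - 1 / α)) (by positivity)
    (Or.inr hμ) 0 n0 (by omega)
  have hch2 := chain hα hK hc h.H' h.H.br (K / α) hν0 (Or.inl le_rfl) n0 (b - 1 - n0) (by omega)
  rw [show n0 + 1 + (b - 1 - n0) = b by omega] at hch2
  rw [show 0 + 1 + n0 = n0 + 1 by ring, show 0 + 1 = 1 by rfl] at hch1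
  have hB := h.symm.A_rpow
  have hpown : (2 / k * c ^ (1 - 1 / α)) ^ n0 ≤ (2 / k) ^ n0 * (c ^ α * c) := by
    rw [mul_pow]
    apply mul_le_mul_of_nonneg_left _ (by positivity)
    rw [← Real.rpow_natCast, ← Real.rpow_mul hc.le, ← Real.rpow_add_one hc.ne']
    apply Real.rpow_le_rpow_of_exponent_ge hc hc1
    linarith
  have hcα : 0 < c ^ α := Real.rpow_pos_of_pos hc _
  have hfin : ((d - ρ) / d) ^ α ≤ (ε * c) ^ α := by
    rw [Real.mul_rpow hε.le hc.le]
    calc ((d - ρ) / d) ^ α ≤ K * Real.log ((c - x' b) / (c - y' b)) := hB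
      _ ≤ K * ((K / α) ^ (b - 1 - n0) *
          (((2 / k) ^ n0 * (c ^ α * c)) * (M / c))) := by
        apply mul_le_mul_of_nonneg_left _ hK0.le
        refine hch2.trans ?_
        apply mul_le_mul_of_nonneg_left _ (by positivity)
        refine hch1.trans ?_
        exact mul_le_mul hpown hZ1 hZ0 (by positivity)
      _ = (K * M * (2 / k) ^ n0 * (K / α) ^ (b - 1 - n0)) * c ^ α := by field_simp
      _ ≤ _ := mul_le_mul_of_nonneg_right (hN _ (by omega)) hcα.le
  exact (Real.rpow_le_rpow_iff (div_nonneg (by linarith [h.H'.lc]) hd.le) (by positivity) hα0).1 hfin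

lemma Pair.Z1_log (h : Pair α K c d f g a b l ρ p q x y x' y') (hB : (d - ρ) / d ≤ c) :
    0 < (c - p) / c - (c - l) / c ∧
    Real.log ((d - x 1) / (d - y 1)) ≤
      Real.log (3 * K / ((c - p) / c - (c - l) / c)) := by
  obtain ⟨hz1, hpos, hz⟩ := h.Z1_rpow
  have hc := h.hc
  have hd := h.hd
  have hcd1 := h.hcd
  have hK := h.hK
  have hK0 : 0 < K := by linarith
  have hD : (c - p) / c - (c - l) / c = (l - p) / c := by ring
  have hpl := h.p_lt_l
  have hDpos : 0 < (l - p) / c := div_pos (by linarith) hc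
  have hD1 : (l - p) / c ≤ 1 := by
    rw [div_le_one hc]; linarith [h.H.lc, h.H.p0]
  rw [hD]
  refine ⟨hDpos, Real.log_le_log (by linarith) ((le_rpow_self h.hα hz1).trans (hz.trans ?_))⟩
  set D := (l - p) / c with hDdef
  have e1 : l - p = c * D := by rw [hDdef]; field_simp
  have h1 : y 0 - x 0 ≤ 2 * c := by
    have : d - ρ ≤ c * d := by rwa [div_le_iff₀ hd] at hB
    have : c * d ≤ c * 1 := mul_le_mul_of_nonneg_left (by linarith) hc.le
    linarith [h.H.y0, h.H.x0l, h.H.l0]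
  have h2 : c * D ≤ g d - y 0 := by
    rw [← e1]; linarith [h.symm.fc_ge, h.H.y0]
  have h3 : K * (y 0 - x 0) / (g d - y 0) ≤ K * (2 * c) / (c * D) := by
    apply div_le_div₀ (by positivity) _ (by positivity) h2
    exact mul_le_mul_of_nonneg_left h1 hK0.le
  have h4 : K * (2 * c) / (c * D) = 2 * K / D := by field_simp
  have h5 : 1 ≤ K / D := by rw [le_div_iff₀ hDpos]; linarith
  have h6 : 3 * K / D = 2 * K / D + K / D := by ring
  linarith

lemma pair_PA (hα : 1 < α) (hK : 1 ≤ K) (hKα : K < α) : ∃ p1 : ℝ, 0 < p1 ∧ ∃ N : ℕ,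
    ∀ (c d : ℝ) (f g : ℝ → ℝ) (a b : ℕ) (l ρ p q : ℝ) (x y x' y' : ℕ → ℝ),
      Pair α K c d f g a b l ρ p q x y x' y' → c ≤ d → N ≤ a → N ≤ b →
      p1 ≤ (c - p) / c - (c - l) / c := by
  obtain ⟨N1, hN1⟩ := pair_B hα hK hKα 1 one_pos
  obtain ⟨p0, hp0, hP⟩ := pair_P hα hK
  have hα0 : 0 < α := by linarith
  have hK0 : 0 < K := by linarith
  have hν0 : 0 ≤ K / α := by positivity
  have hν1 : K / α < 1 := by rw [div_lt_one hα0]; exact hKα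
  obtain ⟨N2, hN2⟩ := exists_pow hν0 hν1 1 (1/2) (by norm_num)
  refine ⟨(p0 ^ α) ^ 2 / (3 * K ^ 5 * α ^ 2), by positivity, N1 + N2 + 1, ?_⟩
  intro c d f g a b l ρ p q x y x' y' h hcd ha hb
  have hB := hN1 _ _ _ _ _ _ _ _ _ _ _ _ _ _ h hcd (by omega)
  rw [one_mul] at hB
  obtain ⟨hD, hZ⟩ := h.Z1_log hB
  have hP := hP _ _ _ _ _ _ _ _ _ _ _ _ _ _ h hcd
  have hc := h.hc
  have hlip := rpow_sub_le hα (z := (c - p) / c) (w := (c - l) / c)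
    (div_nonneg (by linarith [h.H.lc]) hc.le) (by linarith)
    (by rw [div_le_one hc]; linarith [h.H.p0])
  have hPA := h.PA_rpow
  have hPα : p0 ^ α ≤ ((c - p) / c) ^ α := Real.rpow_le_rpow hp0.le hP hα0.le
  have hch := chain hα hK h.hd h.H h.H'.br (K / α) hν0 (Or.inl le_rfl) 0 (a - 1) (by omega)
  rw [show 0 + 1 + (a - 1) = a by omega, show 0 + 1 = 1 by rfl] at hch
  have hpw := hN2 (a - 1) (by omega)
  rw [one_mul] at hpw
  obtain ⟨hz1, -, -⟩ := h.Z1_rpow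
  have hZ0 : 0 ≤ Real.log ((d - x 1) / (d - y 1)) := Real.log_nonneg hz1
  have hya := h.ya_lt
  have hxya := h.H.xy a le_rfl
  have hZa : 0 < (d - x a) / (d - y a) := div_pos (by linarith) (by linarith)
  set D := (c - p) / c - (c - l) / c
  set Z := (d - x a) / (d - y a)
  have h1 : 2 * Real.log Z ≤ Real.log (3 * K / D) := by
    have := mul_le_mul_of_nonneg_right hpw hZ0
    linarith
  have h2 : Z ^ 2 ≤ 3 * K / D := by
    rw [← Real.log_le_log_iff (by positivity) (by positivity), Real.log_pow]
    exact_mod_cast h1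
  have h3 : p0 ^ α ≤ K ^ 2 * Z * (α * D) :=
    hPα.trans (hPA.trans (mul_le_mul_of_nonneg_left hlip (by positivity)))
  have h4 : (p0 ^ α) ^ 2 ≤ (K ^ 2 * Z * (α * D)) ^ 2 := pow_le_pow_left₀ (by positivity) h3 2
  have h5 : (K ^ 2 * Z * (α * D)) ^ 2 = K ^ 4 * (α * D) ^ 2 * Z ^ 2 := by ring
  have h6 : K ^ 4 * (α * D) ^ 2 * Z ^ 2 ≤ K ^ 4 * (α * D) ^ 2 * (3 * K / D) :=
    mul_le_mul_of_nonneg_left h2 (by positivity)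
  have h7 : K ^ 4 * (α * D) ^ 2 * (3 * K / D) = D * (3 * K ^ 5 * α ^ 2) := by field_simp
  rw [div_le_iff₀ (by positivity)]
  linarith

lemma pair_A (hα : 1 < α) (hK : 1 ≤ K) (hKα : K < α) (ε : ℝ) (hε : 0 < ε) : ∃ N : ℕ,
    ∀ (c d : ℝ) (f g : ℝ → ℝ) (a b : ℕ) (l ρ p q : ℝ) (x y x' y' : ℕ → ℝ),
      Pair α K c d f g a b l ρ p q x y x' y' → c ≤ d → N ≤ a → N ≤ b →
      (c - l) / c ≤ ε := by
  obtain ⟨N1, hN1⟩ := pair_B hα hK hKα 1 one_pos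
  obtain ⟨p1, hp1, N3, hP⟩ := pair_PA hα hK hKα
  have hα0 : 0 < α := by linarith
  have hK0 : 0 < K := by linarith
  have hν0 : 0 ≤ K / α := by positivity
  have hν1 : K / α < 1 := by rw [div_lt_one hα0]; exact hKα
  obtain ⟨N2, hN2⟩ := exists_pow hν0 hν1 (K * Real.log (3 * K / p1)) (ε ^ α) (by positivity)
  refine ⟨N1 + N2 + N3 + 1, ?_⟩
  intro c d f g a b l ρ p q x y x' y' h hcd ha hb
  have hB := hN1 _ _ _ _ _ _ _ _ _ _ _ _ _ _ h hcd (by omega)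
  rw [one_mul] at hB
  obtain ⟨hD, hZ⟩ := h.Z1_log hB
  have hP := hP _ _ _ _ _ _ _ _ _ _ _ _ _ _ h hcd (by omega) (by omega)
  have hch := chain hα hK h.hd h.H h.H'.br (K / α) hν0 (Or.inl le_rfl) 0 (a - 1) (by omega)
  rw [show 0 + 1 + (a - 1) = a by omega, show 0 + 1 = 1 by rfl] at hch
  have hpw := hN2 (a - 1) (by omega)
  have hA := h.A_rpow
  have hc := h.hc
  have h1 : Real.log (3 * K / ((c - p) / c - (c - l) / c)) ≤ Real.log (3 * K / p1) :=
    Real.log_le_log (by positivity) (div_le_div_of_nonneg_left (by positivity) hp1 hP)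
  have h2 : Real.log ((d - x a) / (d - y a)) ≤ (K / α) ^ (a - 1) * Real.log (3 * K / p1) :=
    hch.trans (mul_le_mul_of_nonneg_left (hZ.trans h1) (by positivity))
  have h3 := mul_le_mul_of_nonneg_left h2 hK0.le
  have hfin : ((c - l) / c) ^ α ≤ ε ^ α := by linarith
  exact (Real.rpow_le_rpow_iff (div_nonneg (by linarith [h.H.lc]) hc.le) hε.le hα0).1 hfin

lemma core1 (hα : 1 < α) (hK : 1 ≤ K) (hKα : K < α) (τ : ℝ) (hτ : 0 < τ) : ∃ N : ℕ,
    ∀ (c d : ℝ) (f g : ℝ → ℝ) (a b : ℕ) (l ρ p q : ℝ) (x y x' y' : ℕ → ℝ),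
      Pair α K c d f g a b l ρ p q x y x' y' → c ≤ d → N ≤ a → N ≤ b →
      p + τ * (1 - ρ - l) ≤ l ∧ q + τ * (1 - ρ - l) ≤ ρ := by
  obtain ⟨p1, hp1, N1, hN1⟩ := pair_PA hα hK hKα
  obtain ⟨k, hk, hQ⟩ := pair_Q hα hK
  set ε := min (p1 / (2 * τ)) (k / (4 * τ + 1)) with hε
  have hε0 : 0 < ε := lt_min (by positivity) (by positivity)
  obtain ⟨N2, hN2⟩ := pair_B hα hK hKα ε hε0
  obtain ⟨N3, hN3⟩ := pair_A hα hK hKα ε hε0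
  refine ⟨N1 + N2 + N3, ?_⟩
  intro c d f g a b l ρ p q x y x' y' h hcd ha hb
  have hD := hN1 _ _ _ _ _ _ _ _ _ _ _ _ _ _ h hcd (by omega) (by omega)
  have hB := hN2 _ _ _ _ _ _ _ _ _ _ _ _ _ _ h hcd (by omega)
  have hA := hN3 _ _ _ _ _ _ _ _ _ _ _ _ _ _ h hcd (by omega) (by omega)
  have hQ := hQ _ _ _ _ _ _ _ _ _ _ _ _ _ _ h hcd
  have hc := h.hc
  have hd := h.hd
  have hcd1 := h.hcd
  have hε1 : ε * (2 * τ) ≤ p1 := by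
    have : ε ≤ p1 / (2 * τ) := min_le_left _ _
    rwa [le_div_iff₀ (by positivity)] at this
  have hε2 : ε * (4 * τ + 1) ≤ k := by
    have : ε ≤ k / (4 * τ + 1) := min_le_right _ _
    rwa [le_div_iff₀ (by positivity)] at this
  have hroot : c ≤ c ^ (1 / α) := by
    have := Real.rpow_le_rpow_of_exponent_ge hc (by linarith)
      (show 1 / α ≤ 1 by rw [div_le_one (by linarith)]; linarith)
    simpa using this
  have hQ' : k * c ≤ (d - q) / d := (mul_le_mul_of_nonneg_left hroot hk.le).trans hQ
  rw [div_le_iff₀ hd] at hB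
  rw [div_le_iff₀ hc] at hA
  rw [le_div_iff₀ hd] at hQ'
  have e : (c - p) / c - (c - l) / c = (l - p) / c := by ring
  rw [e, le_div_iff₀ hc] at hD
  have hεc : 0 < ε * c := by positivity
  have hlen : 1 - ρ - l ≤ 2 * (ε * c) := by nlinarith
  have h1 : τ * (1 - ρ - l) ≤ τ * (2 * (ε * c)) := mul_le_mul_of_nonneg_left hlen hτ.le
  constructor
  · have := mul_le_mul_of_nonneg_right hε1 hc.le
    nlinarith
  · have h2 := mul_le_mul_of_nonneg_right hε2 (show 0 ≤ c * d by positivity)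
    have h3 : τ * (2 * (ε * c)) ≤ ε * (4 * τ) * (c * d) := by
      have : τ * (ε * c) * 2 * 1 ≤ τ * (ε * c) * 2 * (2 * d) :=
        mul_le_mul_of_nonneg_left (by linarith) (by positivity)
      linarith
    nlinarith

lemma core (hα : 1 < α) (hK : 1 ≤ K) (hKα : K < α) (τ : ℝ) (hτ : 0 < τ) : ∃ N : ℕ,
    ∀ (c d : ℝ) (f g : ℝ → ℝ) (a b : ℕ) (l ρ p q : ℝ) (x y x' y' : ℕ → ℝ),
      Pair α K c d f g a b l ρ p q x y x' y' → N ≤ a → N ≤ b →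
      p + τ * (1 - ρ - l) ≤ l ∧ q + τ * (1 - ρ - l) ≤ ρ := by
  obtain ⟨N, hN⟩ := core1 hα hK hKα τ hτ
  refine ⟨N, ?_⟩
  intro c d f g a b l ρ p q x y x' y' h ha hb
  rcases le_total c d with hcd | hcd
  · exact hN _ _ _ _ _ _ _ _ _ _ _ _ _ _ h hcd ha hb
  · obtain ⟨h1, h2⟩ := hN _ _ _ _ _ _ _ _ _ _ _ _ _ _ h.symm hcd hb ha
    have e : 1 - l - ρ = 1 - ρ - l := by ring
    rw [e] at h1 h2
    exact ⟨h2, h1⟩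


/-- Orientation preserving homeomorphisms of `[0,1]` with distortion bounded by `K`. -/
structure Dif (K : ℝ) (φ : ℝ → ℝ) : Prop where
  cont : ContinuousOn φ (Icc 0 1)
  mono : StrictMonoOn φ (Icc 0 1)
  fix0 : φ 0 = 0
  fix1 : φ 1 = 1
  dist : ∀ x y x' y' : ℝ, 0 ≤ x → x ≤ y → y ≤ 1 → 0 ≤ x' → x' ≤ y' → y' ≤ 1 →
    (φ y - φ x) * (y' - x') ≤ K * (φ y' - φ x') * (y - x)

lemma Dif.refl {φ : ℝ → ℝ} (h : Dif K φ) : Dif K (fun x => 1 - φ (1 - x)) where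
  cont := by
    apply ContinuousOn.sub continuousOn_const
    apply h.cont.comp (by fun_prop)
    intro x hx
    exact ⟨by linarith [hx.2], by linarith [hx.1]⟩
  mono := by
    intro x hx y hy hxy
    have := h.mono (a := 1 - y) (b := 1 - x) ⟨by linarith [hy.2], by linarith [hy.1]⟩
      ⟨by linarith [hx.2], by linarith [hx.1]⟩ (by linarith)
    simp only
    linarith
  fix0 := by simp [h.fix1]
  fix1 := by simp [h.fix0]
  dist := by
    intro x y x' y' h1 h2 h3 h4 h5 h6
    have := h.dist (1 - y) (1 - x) (1 - y') (1 - x') (by linarith) (by linarith) (by linarith)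
      (by linarith) (by linarith) (by linarith)
    linarith

lemma qm_eq {u x : ℝ} (hc : 0 < c) (hx : x ≤ c) :
    qminus α u c x = u * (1 - ((c - x) / c) ^ α) := by
  unfold qminus
  rw [abs_of_nonneg (div_nonneg (by linarith) hc.le)]

lemma zmono {x y : ℝ} (hα : 1 < α) (hc : 0 < c) (hxy : x < y) (hy : y ≤ c) :
    ((c - y) / c) ^ α < ((c - x) / c) ^ α := by
  apply Real.rpow_lt_rpow (div_nonneg (by linarith) hc.le) _ (by linarith)
  gcongr

lemma qm_mem {u x : ℝ} (hα : 1 < α) (hc : 0 < c) (hu : 0 < u) (hu1 : u ≤ 1)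
    (hx : x ∈ Icc 0 c) : qminus α u c x ∈ Icc (0 : ℝ) 1 := by
  rw [qm_eq hc hx.2]
  have h1 : 0 ≤ ((c - x) / c) ^ α := Real.rpow_nonneg (div_nonneg (by linarith [hx.2]) hc.le) _
  have h2 : ((c - x) / c) ^ α ≤ 1 := by
    apply Real.rpow_le_one (div_nonneg (by linarith [hx.2]) hc.le) _ (by linarith)
    rw [div_le_one hc]; linarith [hx.1]
  constructor
  · nlinarith
  · nlinarith

lemma qm_cont {u : ℝ} (hα : 1 < α) : Continuous (qminus α u c) := by
  unfold qminus
  apply Continuous.mul continuous_const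
  apply Continuous.sub continuous_const
  apply Continuous.rpow_const
  · fun_prop
  · intro x; right; linarith

lemma br_of_dif {φ : ℝ → ℝ} {u : ℝ} (hα : 1 < α) (hc : 0 < c) (hu0 : 0 ≤ u)
    (hu1 : u ≤ 1) (h : Dif K φ) (hleft : ∀ x ∈ Ioc (0:ℝ) c, x < φ (qminus α u c x)) :
    Br α K c (fun x => φ (qminus α u c x)) ∧
      ContinuousOn (fun x => φ (qminus α u c x)) (Icc 0 c) := by
  have hqc : qminus α u c c = u := by rw [qm_eq hc le_rfl, zc hα]; ring
  have hq0 : qminus α u c 0 = 0 := by rw [qm_eq hc hc.le, z0 hc]; ring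
  have hcc := hleft c ⟨hc, le_rfl⟩
  have hu : 0 < u := by
    rcases hu0.lt_or_eq with h1 | h1
    · exact h1
    · rw [hqc, ← h1, h.fix0] at hcc; linarith
  have hmono : StrictMonoOn (fun x => φ (qminus α u c x)) (Icc 0 c) := by
    intro x hx y hy hxy
    apply h.mono (qm_mem hα hc hu hu1 hx) (qm_mem hα hc hu hu1 hy)
    rw [qm_eq hc hx.2, qm_eq hc hy.2]
    have := zmono hα hc hxy hy.2
    nlinarith
  refine ⟨⟨?_, hmono, ?_, ?_, hcc, ?_⟩, ?_⟩
  · intro x y x' y' h1 h2 h3 h4 h5 h6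
    have m : ∀ {x y}, 0 ≤ x → x ≤ y → y ≤ c → qminus α u c x ≤ qminus α u c y := by
      intro x y h1 h2 h3
      rcases h2.eq_or_lt with e | e
      · rw [e]
      · rw [qm_eq hc h3, qm_eq hc (h2.trans h3)]
        have := zmono hα hc e h3
        nlinarith
    have mx := qm_mem hα hc hu hu1 (x := x) ⟨h1, h2.trans h3⟩
    have my := qm_mem hα hc hu hu1 (x := y) ⟨h1.trans h2, h3⟩
    have mx' := qm_mem hα hc hu hu1 (x := x') ⟨h4, h5.trans h6⟩
    have my' := qm_mem hα hc hu hu1 (x := y') ⟨h4.trans h5, h6⟩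
    have := h.dist _ _ _ _ mx.1 (m h1 h2 h3) my.2 mx'.1 (m h4 h5 h6) my'.2
    have e1 : qminus α u c y' - qminus α u c x' =
        u * (((c - x') / c) ^ α - ((c - y') / c) ^ α) := by
      rw [qm_eq hc h6, qm_eq hc (h5.trans h6)]; ring
    have e2 : qminus α u c y - qminus α u c x =
        u * (((c - x) / c) ^ α - ((c - y) / c) ^ α) := by
      rw [qm_eq hc h3, qm_eq hc (h2.trans h3)]; ring
    rw [e1, e2] at this
    refine le_of_mul_le_mul_left ?_ hu
    linarith
  · simp only [hq0, h.fix0]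
  · intro x hx
    rcases hx.1.eq_or_lt with e | e
    · rw [← e]; simp only [hq0, h.fix0]; exact le_rfl
    · exact (hleft x ⟨e, hx.2⟩).le
  · simp only [hqc]
    rw [← h.fix1]
    exact h.mono.monotoneOn ⟨hu0, hu1⟩ ⟨zero_le_one, le_rfl⟩ hu1
  · exact h.cont.comp (qm_cont hα).continuousOn (fun x hx => qm_mem hα hc hu hu1 hx)

/-- Construction of the orbits. -/
lemma orbit {a : ℕ} {l ρ : ℝ} (hc : 0 < c) (hcd : c + d = 1) (_ha : 1 ≤ a)
    (hf : Br α K c f) (hfc : ContinuousOn f (Icc 0 c))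
    (hg : Br α K d g) (hgc : ContinuousOn g (Icc 0 d)) (hl0 : 0 ≤ l) (hlc : l < c)
    (h1 : ∀ i < a, ∀ x ∈ Ico l c, g^[i] (1 - f x) < d)
    (h2 : ∀ z ∈ Ico l c, ∃ x ∈ Ico l c, g^[a] (1 - f x) = 1 - z)
    (h3 : ∀ x ∈ Ico l c, ρ ≤ g^[a] (1 - f x) ∧ g^[a] (1 - f x) ≤ 1 - l)
    {p : ℝ} (hp : p ∈ Icc 0 c) (hfp : f p = c) :
    Half α K c d f g a l ρ p (fun i => g^[a - i] (1 - f c)) (fun i => g^[a - i] (1 - f l)) := by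
  have hsub : Icc l c ⊆ Icc 0 c := Icc_subset_Icc_left hl0
  have hlmem : l ∈ Icc l c := ⟨le_rfl, hlc.le⟩
  have hcmem : c ∈ Icc l c := ⟨hlc.le, le_rfl⟩
  have key : ∀ i, i ≤ a → StrictAntiOn (fun x => g^[i] (1 - f x)) (Icc l c) ∧
      ContinuousOn (fun x => g^[i] (1 - f x)) (Icc l c) ∧
      ∀ x ∈ Icc l c, 0 ≤ g^[i] (1 - f x) := by
    intro i
    induction i with
    | zero =>
      intro _
      simp only [Function.iterate_zero, id]
      refine ⟨?_, continuousOn_const.sub (hfc.mono hsub), ?_⟩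
      · intro x hx y hy hxy
        have := hf.mono (hsub hx) (hsub hy) hxy
        simp only; linarith
      · intro x hx
        have := hf.mono.monotoneOn (hsub hx) ⟨hc.le, le_rfl⟩ hx.2
        linarith [hf.le1]
    | succ i ih =>
      intro hi
      obtain ⟨k1, k2, k3⟩ := ih (by omega)
      have maps : ∀ x ∈ Icc l c, g^[i] (1 - f x) ∈ Icc 0 d := by
        intro x hx
        refine ⟨k3 x hx, ?_⟩
        have e1 := h1 i (by omega) l ⟨le_rfl, hlc⟩
        have e2 := k1.antitoneOn hlmem hx hx.1
        linarith
      simp only [Function.iterate_succ_apply']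
      refine ⟨?_, hgc.comp k2 maps, ?_⟩
      · intro x hx y hy hxy
        exact hg.mono (maps y hy) (maps x hx) (k1 hx hy hxy)
      · intro x hx
        exact (k3 x hx).trans (hg.ge _ (maps x hx))
  obtain ⟨ka1, ka2, ka3⟩ := key a le_rfl
  refine ⟨hf, hl0, hlc, hp.1, hp.2, hfp, by simp, by simp, ?_, ?_, ?_, ?_, ?_, ?_, ?_, ?_⟩
  · simp only [Nat.sub_zero]
    apply le_antisymm (h3 l ⟨le_rfl, hlc⟩).2
    obtain ⟨x, hx, e⟩ := h2 l ⟨le_rfl, hlc⟩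
    rw [← e]
    exact ka1.antitoneOn hlmem ⟨hx.1, hx.2.le⟩ hx.1
  · simp only [Nat.sub_zero]
    have hcl : c ∈ closure (Ico l c) := by
      rw [closure_Ico hlc.ne]; exact hcmem
    have hcw : ContinuousWithinAt (fun x => g^[a] (1 - f x)) (Ico l c) c :=
      (ka2 c hcmem).mono Ico_subset_Icc_self
    exact ContinuousWithinAt.closure_le hcl continuousWithinAt_const hcw (fun x hx => (h3 x hx).1)
  · simp only [Nat.sub_zero]
    by_contra hh
    push Not at hh
    set t := g^[a] (1 - f c) with ht
    obtain ⟨x, hx, e⟩ := h2 (max l (1 - t)) ⟨le_max_left _ _, max_lt hlc (by linarith)⟩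
    have e1 := ka1 ⟨hx.1, hx.2.le⟩ hcmem hx.2
    simp only at e1
    rw [e, ← ht] at e1
    have := le_max_right l (1 - t)
    linarith
  · intro i hi
    rw [← Function.iterate_succ_apply' g, show (a - (i+1)).succ = a - i by omega]
  · intro i hi
    rw [← Function.iterate_succ_apply' g, show (a - (i+1)).succ = a - i by omega]
  · intro i hi
    exact (key (a - (i+1)) (by omega)).2.2 c hcmem
  · intro i hi
    exact (key (a - i) (by omega)).1.antitoneOn hlmem hcmem hlc.le
  · intro i hi
    exact h1 (a - (i+1)) (by omega) l ⟨le_rfl, hlc⟩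

lemma diffeoNorm_nonneg (φ : ℝ → ℝ) : 0 ≤ diffeoNorm φ := by
  apply Real.sSup_nonneg
  rintro _ ⟨x, _, rfl⟩
  exact abs_nonneg _

lemma deriv_facts {φ : ℝ → ℝ} (h : IsSDiffeo φ) :
    BddAbove ((fun x => |nonlinearity φ x|) '' Icc 0 1) ∧
    (∀ x ∈ Ioo (0:ℝ) 1, DifferentiableAt ℝ (deriv φ) x) := by
  have hu : UniqueDiffOn ℝ (Icc (0:ℝ) 1) := uniqueDiffOn_Icc one_pos
  have hd1 : ContDiffOn ℝ 2 (derivWithin φ (Icc 0 1)) (Icc 0 1) :=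
    h.contDiff.derivWithin hu (by norm_num)
  have hd2 : ContDiffOn ℝ 1 (derivWithin (derivWithin φ (Icc 0 1)) (Icc 0 1)) (Icc 0 1) :=
    hd1.derivWithin hu (by norm_num)
  have heq : ∀ x ∈ Icc (0:ℝ) 1, derivWithin φ (Icc 0 1) x = deriv φ x := by
    intro x hx
    exact (differentiableAt_of_deriv_ne_zero (h.derivPos x hx).ne').derivWithin (hu x hx)
  have hnhds : ∀ x ∈ Ioo (0:ℝ) 1, derivWithin φ (Icc 0 1) =ᶠ[𝓝 x] deriv φ := by
    intro x hx
    filter_upwards [Icc_mem_nhds hx.1 hx.2] with y hy using heq y hy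
  have hdd : ∀ x ∈ Ioo (0:ℝ) 1, DifferentiableAt ℝ (deriv φ) x := by
    intro x hx
    have h1 : DifferentiableAt ℝ (derivWithin φ (Icc 0 1)) x :=
      (hd1.differentiableOn (by norm_num) x (Ioo_subset_Icc_self hx)).differentiableAt
        (Icc_mem_nhds hx.1 hx.2)
    exact h1.congr_of_eventuallyEq (hnhds x hx).symm
  refine ⟨?_, hdd⟩
  have hcont : ContinuousOn (fun x => |derivWithin (derivWithin φ (Icc 0 1)) (Icc 0 1) x /
      derivWithin φ (Icc 0 1) x|) (Icc 0 1) := by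
    apply ContinuousOn.abs
    apply hd2.continuousOn.div hd1.continuousOn
    intro x hx
    rw [heq x hx]; exact (h.derivPos x hx).ne'
  obtain ⟨M, hM⟩ := isCompact_Icc.bddAbove_image hcont
  refine ⟨max M (max |nonlinearity φ 0| |nonlinearity φ 1|), ?_⟩
  rintro _ ⟨x, hx, rfl⟩
  rcases hx.1.eq_or_lt with e | e
  · rw [← e]; simp
  rcases hx.2.eq_or_lt with e' | e'
  · rw [e']; simp
  refine le_max_of_le_left ?_
  have hx' : x ∈ Ioo (0:ℝ) 1 := ⟨e, e'⟩
  have := hM ⟨x, hx, rfl⟩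
  simp only at this
  rw [heq x hx, derivWithin_of_mem_nhds (Icc_mem_nhds e e'), (hnhds x hx').deriv_eq] at this
  exact this

lemma dif_of_sdiffeo {φ : ℝ → ℝ} {δ : ℝ} (h : IsSDiffeo φ) (hn : diffeoNorm φ < δ) :
    Dif (Real.exp δ) φ := by
  obtain ⟨hbdd, hdd⟩ := deriv_facts h
  have hcont := h.contDiff.continuousOn
  have hmono : StrictMonoOn φ (Icc 0 1) := by
    apply strictMonoOn_of_deriv_pos (convex_Icc 0 1) hcont
    intro x hx
    exact h.derivPos x (interior_subset hx)
  have hδ : 0 < δ := (diffeoNorm_nonneg φ).trans_lt hn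
  have hlog : ∀ x ∈ Ioo (0:ℝ) 1, ∀ y ∈ Ioo (0:ℝ) 1,
      deriv φ x ≤ Real.exp δ * deriv φ y := by
    intro x hx y hy
    have hb : ‖Real.log (deriv φ x) - Real.log (deriv φ y)‖ ≤ δ * ‖x - y‖ := by
      apply Convex.norm_image_sub_le_of_norm_deriv_le (f := fun x => Real.log (deriv φ x))
        (s := Ioo (0:ℝ) 1) _ _ (convex_Ioo 0 1) hy hx
      · intro z hz
        exact (hdd z hz).log (h.derivPos z (Ioo_subset_Icc_self hz)).ne'
      · intro z hz
        rw [deriv.log (hdd z hz) (h.derivPos z (Ioo_subset_Icc_self hz)).ne', Real.norm_eq_abs]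
        have : |nonlinearity φ z| ≤ diffeoNorm φ :=
          le_csSup hbdd ⟨z, Ioo_subset_Icc_self hz, rfl⟩
        exact this.trans hn.le
    have h1 : ‖x - y‖ ≤ 1 := by
      rw [Real.norm_eq_abs, abs_le]
      constructor <;> linarith [hx.1, hx.2, hy.1, hy.2]
    have h2 : Real.log (deriv φ x) - Real.log (deriv φ y) ≤ δ := by
      have := le_abs_self (Real.log (deriv φ x) - Real.log (deriv φ y))
      rw [Real.norm_eq_abs] at hb
      nlinarith
    have px := h.derivPos x (Ioo_subset_Icc_self hx)
    have py := h.derivPos y (Ioo_subset_Icc_self hy)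
    rw [← Real.log_le_log_iff px (by positivity), Real.log_mul (by positivity) py.ne',
      Real.log_exp]
    linarith
  refine ⟨hcont, hmono, h.fix0, h.fix1, ?_⟩
  intro x y x' y' h1 h2 h3 h4 h5 h6
  have mvt : ∀ {x y : ℝ}, 0 ≤ x → x < y → y ≤ 1 →
      ∃ z ∈ Ioo (0:ℝ) 1, φ y - φ x = deriv φ z * (y - x) := by
    intro x y h1 h2 h3
    obtain ⟨z, hz, e⟩ := exists_deriv_eq_slope φ h2 (hcont.mono (Icc_subset_Icc h1 h3))
      (fun w hw => (differentiableAt_of_deriv_ne_zero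
        (h.derivPos w ⟨by linarith [hw.1], by linarith [hw.2]⟩).ne').differentiableWithinAt)
    refine ⟨z, ⟨by linarith [hz.1], by linarith [hz.2]⟩, ?_⟩
    rw [e, div_mul_cancel₀]
    linarith
  rcases h2.eq_or_lt with e | e
  · rw [e]; simp
  rcases h5.eq_or_lt with e' | e'
  · rw [e']; simp
  obtain ⟨z, hz, ez⟩ := mvt h1 e h3
  obtain ⟨z', hz', ez'⟩ := mvt h4 e' h6
  rw [ez, ez']
  have := mul_le_mul_of_nonneg_right (hlog z hz z' hz')
    (show 0 ≤ (y - x) * (y' - x') from mul_nonneg (by linarith) (by linarith))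
  linarith

lemma iter_left (F : LorenzMap α) {l : ℝ} {a : ℕ}
    (h : ∀ i, 1 ≤ i → i ≤ a → ∀ x ∈ Ico l F.c, F.c < F.toFun^[i] x) :
    ∀ i ≤ a, ∀ x ∈ Ico l F.c,
      (fun X => 1 - F.fp (1 - X))^[i] (1 - F.fm x) = 1 - F.toFun^[i+1] x := by
  intro i
  induction i with
  | zero =>
    intro _ x hx
    simp [LorenzMap.toFun, hx.2]
  | succ i ih =>
    intro hi x hx
    rw [Function.iterate_succ_apply', ih (by omega) x hx, Function.iterate_succ_apply' _ (i+1)]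
    have := h (i+1) (by omega) hi x hx
    simp only [sub_sub_cancel]
    conv_rhs => rw [LorenzMap.toFun]
    rw [if_neg (not_lt.2 this.le)]

lemma iter_right (F : LorenzMap α) {r : ℝ} {b : ℕ}
    (h : ∀ i, 1 ≤ i → i ≤ b → ∀ x ∈ Ioc F.c r, F.toFun^[i] x < F.c) :
    ∀ i ≤ b, ∀ x ∈ Ioc F.c r, F.fm^[i] (F.fp x) = F.toFun^[i+1] x := by
  intro i
  induction i with
  | zero =>
    intro _ x hx
    simp [LorenzMap.toFun, hx.1.le]
  | succ i ih =>
    intro hi x hx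
    rw [Function.iterate_succ_apply', ih (by omega) x hx, Function.iterate_succ_apply' _ (i+1)]
    have := h (i+1) (by omega) hi x hx
    conv_rhs => rw [LorenzMap.toFun]
    rw [if_pos this]

lemma reduction {δ : ℝ} (hα : 1 < α) (hδ0 : 0 < δ) (hδ : δ < Real.log α)
    (F : LorenzMap α) (a b : ℕ) (l r : ℝ) (hm : F.memL δ) (hr : ABRenormWith F a b l r)
    (ha : 2 ≤ a) (hb : 2 ≤ b) :
    ∃ x y x' y', Pair α (Real.exp δ) F.c (1 - F.c) F.fm (fun X => 1 - F.fp (1 - X)) a b l (1 - r)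
      (F.fmInv F.c) (1 - F.fpInv F.c) x y x' y' := by
  obtain ⟨⟨⟨G, hl0, hlc, hcr, hr1, -⟩, -⟩, -, -, c1, -, c2, c3, c4, -, c5, c6⟩ := hr
  have hc := F.hc.1
  have hd : 0 < 1 - F.c := by linarith [F.hc.2]
  obtain ⟨brf, cf⟩ := br_of_dif hα hc F.hu.1 F.hu.2 (dif_of_sdiffeo F.hφ hm.1) F.hleft
  have gform : (fun X => 1 - F.fp (1 - X)) =
      fun x => (fun x => 1 - F.ψ (1 - x)) (qminus α F.v (1 - F.c) x) := by
    funext X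
    simp only [LorenzMap.fp, qplus, qminus]
    congr 2
    have : (1 - X - F.c) = (1 - F.c - X) := by ring
    rw [this]; ring
  have hgl : ∀ x ∈ Ioc (0:ℝ) (1 - F.c),
      x < (fun x => 1 - F.ψ (1 - x)) (qminus α F.v (1 - F.c) x) := by
    intro x hx
    have e := congrFun gform x
    simp only at e
    simp only
    rw [← e]
    have := F.hright (1 - x) ⟨by linarith [hx.2], by linarith [hx.1]⟩
    simp only [LorenzMap.fp]
    linarith
  obtain ⟨brg, cg⟩ := br_of_dif hα hd F.hv.1 F.hv.2 (dif_of_sdiffeo F.hψ hm.2).refl hgl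
  rw [← gform] at brg cg
  change Br α (Real.exp δ) F.c F.fm at brf
  change ContinuousOn F.fm (Icc 0 F.c) at cf
  set g : ℝ → ℝ := fun X => 1 - F.fp (1 - X) with hg
  have hp : ∃ p ∈ Icc 0 F.c, F.fm p = F.c := by
    have := intermediate_value_Icc hc.le cf
    obtain ⟨p, hp, e⟩ := this ⟨by rw [brf.f0]; exact hc.le, brf.lt.le⟩
    exact ⟨p, hp, e⟩
  have hq : ∃ q ∈ Icc F.c 1, F.fp q = F.c := by
    have := intermediate_value_Icc hd.le cg
    obtain ⟨q, hq, e⟩ := this ⟨by rw [brg.f0]; exact hd.le, brg.lt.le⟩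
    refine ⟨1 - q, ⟨by linarith [hq.2], by linarith [hq.1]⟩, ?_⟩
    simp only [hg] at e
    linarith
  have hp1 : F.fmInv F.c ∈ Icc 0 F.c := invFunOn_mem hp
  have hp2 : F.fm (F.fmInv F.c) = F.c := invFunOn_eq hp
  have hq1 : F.fpInv F.c ∈ Icc F.c 1 := invFunOn_mem hq
  have hq2 : F.fp (F.fpInv F.c) = F.c := invFunOn_eq hq
  have it1 := iter_left F c1
  have it2 := iter_right F c4
  have H := orbit (a := a) (l := l) (ρ := 1 - r) hc (show F.c + (1 - F.c) = 1 by ring) (by omega)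
    brf cf brg cg hl0 hlc
    (by
      intro i hi x hx
      have e := it1 i hi.le x hx
      rw [← hg] at e
      rw [e]
      linarith [c1 (i+1) (by omega) hi x hx])
    (by
      intro z hz
      obtain ⟨x, hx, e⟩ := c2 hz
      refine ⟨x, hx, ?_⟩
      have e' := it1 a le_rfl x hx
      rw [← hg] at e'
      rw [e', e])
    (by
      intro x hx
      have e' := it1 a le_rfl x hx
      rw [← hg] at e'
      rw [e']
      have := c3 ⟨x, hx, rfl⟩
      exact ⟨by linarith [this.2], by linarith [this.1]⟩) hp1 hp2
  have gsub : ∀ x, 1 - g x = F.fp (1 - x) := by intro x; simp [hg]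
  have H' := orbit (a := b) (l := 1 - r) (ρ := l) hd (show (1 - F.c) + F.c = 1 by ring) (by omega)
    brg cg brf cf (by linarith) (by linarith)
    (by
      intro i hi x hx
      have hx' : 1 - x ∈ Ioc F.c r := ⟨by linarith [hx.2], by linarith [hx.1]⟩
      rw [gsub, it2 i hi.le _ hx']
      exact c4 (i+1) (by omega) hi _ hx')
    (by
      intro z hz
      have hz' : 1 - z ∈ Ioc F.c r := ⟨by linarith [hz.2], by linarith [hz.1]⟩
      obtain ⟨x, hx, e⟩ := c5 hz'
      refine ⟨1 - x, ⟨by linarith [hx.2], by linarith [hx.1]⟩, ?_⟩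
      rw [gsub, sub_sub_cancel, it2 b le_rfl _ hx, e])
    (by
      intro x hx
      have hx' : 1 - x ∈ Ioc F.c r := ⟨by linarith [hx.2], by linarith [hx.1]⟩
      rw [gsub, it2 b le_rfl _ hx']
      have := c6 ⟨_, hx', rfl⟩
      exact ⟨this.1, by linarith [this.2]⟩)
    (p := 1 - F.fpInv F.c) ⟨by linarith [hq1.2], by linarith [hq1.1]⟩
    (by simp only [hg, sub_sub_cancel, hq2])
  refine ⟨_, _, _, _, hα, ?_, ?_, hc, hd, by ring, H, H', ha, hb⟩
  · exact Real.one_le_exp hδ0.le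
  · rw [← Real.lt_log_iff_exp_lt (by linarith)]; exact hδ

end
end KS

/-- **Koebe space.** For every `δ < (log α)/2` and `τ > 0` there exists `N < ∞` such
that if `f ∈ L_δ` is `(a,b)`-renormalizable with `min{a,b} ≥ N`, then
`[f₋⁻¹(c), f₊⁻¹(c)]` contains a `τ`-scaled neighborhood of the return interval
`C = [l,r]`, i.e. `f₋⁻¹(c) ≤ l - τ|C|` and `r + τ|C| ≤ f₊⁻¹(c)`. -/
theorem koebe_space (α : ℝ) (hα : 1 < α) (δ τ : ℝ) (hδ : δ < Real.log α / 2)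
    (hτ : 0 < τ) :
    ∃ N : ℕ, ∀ (f : LorenzMap α) (a b : ℕ) (l r : ℝ),
      f.memL δ → ABRenormWith f a b l r → N ≤ min a b →
      f.fmInv f.c ≤ l - τ * (r - l) ∧ r + τ * (r - l) ≤ f.fpInv f.c := by
  rcases le_or_gt δ 0 with h0 | h0
  · refine ⟨0, fun f a b l r hm _ _ => ?_⟩
    exact absurd (hm.1.trans_le h0) (not_lt.2 (KS.diffeoNorm_nonneg f.φ))
  have hlog : 0 < Real.log α := Real.log_pos hα
  have hK1 : 1 ≤ Real.exp δ := Real.one_le_exp h0.le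
  have hKα : Real.exp δ < α := by
    rw [← Real.lt_log_iff_exp_lt (by linarith)]; linarith
  obtain ⟨N, hN⟩ := KS.core hα hK1 hKα τ hτ
  refine ⟨N + 2, fun f a b l r hm hr hab => ?_⟩
  have ha : N + 2 ≤ a := hab.trans (min_le_left _ _)
  have hb : N + 2 ≤ b := hab.trans (min_le_right _ _)
  obtain ⟨x, y, x', y', h⟩ := KS.reduction hα h0 (by linarith) f a b l r hm hr
    (by omega) (by omega)
  obtain ⟨h1, h2⟩ := hN _ _ _ _ _ _ _ _ _ _ _ _ _ _ h (by omega) (by omega)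
  have e : 1 - (1 - r) - l = r - l := by ring
  rw [e] at h1 h2
  exact ⟨by linarith, by linarith⟩
end
end
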